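/- Let A ⊆ C be an inclusion of C*-algebras such that A is σ-unital and AC is dense in C, and let A^s = A⊗K ⊆ C^s = C⊗K be the stabilized inclusion. Suppose (C^s)' ∩ M(C^s) = C·1. Then there is an exact sequence 1 → K(M(C^s))/U(M(A^s)) → Pic(A^s, C^s) → S(A^s, C^s) → 1, where the second map sends the class of a unitary u to [A^s u, C^s] and the third map is f_{C^s}: [X,Y] ↦ [Y]. In particular, Ker f_{C^s} ≅ K(M(C^s))/U(M(A^s)) and Im f_{C^s} = S(A^s, C^s). -/

import Mathlib

open scoped MultiplierAlgebra

noncomputable section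

structure EquivBimodule (C D Y : Type*)
    [NonUnitalCStarAlgebra C] [PartialOrder C] [StarOrderedRing C]
    [NonUnitalCStarAlgebra D] [PartialOrder D] [StarOrderedRing D]
    [NormedAddCommGroup Y] [NormedSpace ℂ Y] [CompleteSpace Y] : Type _ where
  lsmul : C → Y → Y
  rsmul : Y → D → Y
  linn : Y → Y → C
  rinn : Y → Y → D
  lsmul_add : ∀ c x y, lsmul c (x + y) = lsmul c x + lsmul c y
  add_lsmul : ∀ c c' x, lsmul (c + c') x = lsmul c x + lsmul c' x
  mul_lsmul : ∀ c c' x, lsmul (c * c') x = lsmul c (lsmul c' x)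
  smul_lsmul : ∀ (z : ℂ) c x, lsmul (z • c) x = z • lsmul c x
  lsmul_smul : ∀ (z : ℂ) c x, lsmul c (z • x) = z • lsmul c x
  add_rsmul : ∀ x y d, rsmul (x + y) d = rsmul x d + rsmul y d
  rsmul_add : ∀ x d d', rsmul x (d + d') = rsmul x d + rsmul x d'
  rsmul_mul : ∀ x d d', rsmul x (d * d') = rsmul (rsmul x d) d'
  rsmul_smul : ∀ (z : ℂ) x d, rsmul (z • x) d = z • rsmul x d
  smul_rsmul : ∀ (z : ℂ) x d, rsmul x (z • d) = z • rsmul x d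
  lsmul_rsmul : ∀ c x d, rsmul (lsmul c x) d = lsmul c (rsmul x d)
  linn_add_left : ∀ x y z, linn (x + y) z = linn x z + linn y z
  linn_smul_left : ∀ (t : ℂ) x y, linn (t • x) y = t • linn x y
  linn_star : ∀ x y, star (linn x y) = linn y x
  linn_lsmul_left : ∀ c x y, linn (lsmul c x) y = c * linn x y
  linn_nonneg : ∀ x, 0 ≤ linn x x
  linn_definite : ∀ x, linn x x = 0 → x = 0
  rinn_add_right : ∀ x y z, rinn x (y + z) = rinn x y + rinn x z
  rinn_smul_right : ∀ (t : ℂ) x y, rinn x (t • y) = t • rinn x y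
  rinn_star : ∀ x y, star (rinn x y) = rinn y x
  rinn_rsmul_right : ∀ x y d, rinn x (rsmul y d) = rinn x y * d
  rinn_nonneg : ∀ x, 0 ≤ rinn x x
  rinn_definite : ∀ x, rinn x x = 0 → x = 0
  imprimitivity : ∀ x y z, lsmul (linn x y) z = rsmul x (rinn y z)
  norm_linn : ∀ x, ‖linn x x‖ = ‖x‖ ^ 2
  norm_rinn : ∀ x, ‖rinn x x‖ = ‖x‖ ^ 2
  full_left : Dense (Submodule.span ℂ {c : C | ∃ x y, c = linn x y} : Set C)
  full_right : Dense (Submodule.span ℂ {d : D | ∃ x y, d = rinn x y} : Set D)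

namespace EquivBimodule

variable {C D Y W : Type*}
    [NonUnitalCStarAlgebra C] [PartialOrder C] [StarOrderedRing C]
    [NonUnitalCStarAlgebra D] [PartialOrder D] [StarOrderedRing D]
    [NormedAddCommGroup Y] [NormedSpace ℂ Y] [CompleteSpace Y]
    [NormedAddCommGroup W] [NormedSpace ℂ W] [CompleteSpace W]

structure Iso (E : EquivBimodule C D Y) (F : EquivBimodule C D W) where
  toEquiv : Y ≃ₗ[ℂ] W
  map_lsmul : ∀ c y, toEquiv (E.lsmul c y) = F.lsmul c (toEquiv y)
  map_rsmul : ∀ y d, toEquiv (E.rsmul y d) = F.rsmul (toEquiv y) d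
  map_linn : ∀ x y, F.linn (toEquiv x) (toEquiv y) = E.linn x y
  map_rinn : ∀ x y, F.rinn (toEquiv x) (toEquiv y) = E.rinn x y

end EquivBimodule

def DenseIncl {A C : Type*} [NonUnitalCStarAlgebra C] (ι : A → C) : Prop :=
  Dense (Submodule.span ℂ {x : C | ∃ (a : A) (c : C), x = ι a * c} : Set C)

structure IsMoritaIncl {A B C D Y : Type*}
    [NonUnitalCStarAlgebra C] [PartialOrder C] [StarOrderedRing C]
    [NonUnitalCStarAlgebra D] [PartialOrder D] [StarOrderedRing D]
    [NormedAddCommGroup Y] [NormedSpace ℂ Y] [CompleteSpace Y]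
    (ιA : A → C) (ιB : B → D)
    (E : EquivBimodule C D Y) (X : Submodule ℂ Y) : Prop where
  closed : IsClosed (X : Set Y)
  lsmul_mem : ∀ (a : A), ∀ x ∈ X, E.lsmul (ιA a) x ∈ X
  rsmul_mem : ∀ (b : B), ∀ x ∈ X, E.rsmul x (ιB b) ∈ X
  linn_mem : ∀ x ∈ X, ∀ y ∈ X, E.linn x y ∈ Set.range ιA
  rinn_mem : ∀ x ∈ X, ∀ y ∈ X, E.rinn x y ∈ Set.range ιB
  span_XX_left :
    closure (Submodule.span ℂ {c : C | ∃ x ∈ X, ∃ y ∈ X, c = E.linn x y} : Set C) = Set.range ιA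
  span_YX_left :
    Dense (Submodule.span ℂ {c : C | ∃ (y : Y), ∃ x ∈ X, c = E.linn y x} : Set C)
  span_XX_right :
    closure (Submodule.span ℂ {d : D | ∃ x ∈ X, ∃ y ∈ X, d = E.rinn x y} : Set D) = Set.range ιB
  span_YX_right :
    Dense (Submodule.span ℂ {d : D | ∃ (y : Y), ∃ x ∈ X, d = E.rinn y x} : Set D)

abbrev IsEquiPair {A C Y : Type*}
    [NonUnitalCStarAlgebra C] [PartialOrder C] [StarOrderedRing C]
    [NormedAddCommGroup Y] [NormedSpace ℂ Y] [CompleteSpace Y]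
    (ι : A → C) (E : EquivBimodule C C Y) (X : Submodule ℂ Y) : Prop :=
  IsMoritaIncl ι ι E X

def PairEquiv {C D Y W : Type*}
    [NonUnitalCStarAlgebra C] [PartialOrder C] [StarOrderedRing C]
    [NonUnitalCStarAlgebra D] [PartialOrder D] [StarOrderedRing D]
    [NormedAddCommGroup Y] [NormedSpace ℂ Y] [CompleteSpace Y]
    [NormedAddCommGroup W] [NormedSpace ℂ W] [CompleteSpace W]
    (E : EquivBimodule C D Y) (X : Submodule ℂ Y)
    (F : EquivBimodule C D W) (Z : Submodule ℂ W) : Prop :=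
  ∃ Φ : E.Iso F, X.map Φ.toEquiv.toLinearMap = Z

def IsTrivialData {C : Type*}
    [NonUnitalCStarAlgebra C] [PartialOrder C] [StarOrderedRing C]
    (T : EquivBimodule C C C) : Prop :=
  T.lsmul = (fun c x => c * x) ∧ T.rsmul = (fun x c => x * c) ∧
    T.linn = (fun x y => x * star y) ∧ T.rinn = (fun x y => star x * y)

/-- The data of the equivalence bimodule `Y_σ` induced by an automorphism with
underlying map `σ` (with inverse `σinv`). -/
def IsAlphaData {C : Type*}
    [NonUnitalCStarAlgebra C] [PartialOrder C] [StarOrderedRing C]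
    (σ σinv : C → C) (T : EquivBimodule C C C) : Prop :=
  T.lsmul = (fun c x => c * x) ∧ T.rsmul = (fun x c => x * σ c) ∧
    T.linn = (fun x y => x * star y) ∧ T.rinn = (fun x y => σinv (star x * y))

/-- The submodule `{ι a | a : A}` of `C`, e.g. the subspace `X_α = A` of `Y_α = C`. -/
def rangeSub {A C : Type*} [NonUnitalCStarAlgebra C]
    (ι : A → C) : Submodule ℂ C :=
  Submodule.span ℂ (Set.range ι)

/-- A realization of the interior tensor product `Y ⊗_D W` of equivalence bimodules. -/
structure IsTensorProd {C D L Y W V : Type*}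
    [NonUnitalCStarAlgebra C] [PartialOrder C] [StarOrderedRing C]
    [NonUnitalCStarAlgebra D] [PartialOrder D] [StarOrderedRing D]
    [NonUnitalCStarAlgebra L] [PartialOrder L] [StarOrderedRing L]
    [NormedAddCommGroup Y] [NormedSpace ℂ Y] [CompleteSpace Y]
    [NormedAddCommGroup W] [NormedSpace ℂ W] [CompleteSpace W]
    [NormedAddCommGroup V] [NormedSpace ℂ V] [CompleteSpace V]
    (E : EquivBimodule C D Y) (G : EquivBimodule D L W)
    (F : EquivBimodule C L V) (s : Y → W → V) : Prop where
  add_left : ∀ y y' w, s (y + y') w = s y w + s y' w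
  smul_left : ∀ (z : ℂ) y w, s (z • y) w = z • s y w
  add_right : ∀ y w w', s y (w + w') = s y w + s y w'
  smul_right : ∀ (z : ℂ) y w, s y (z • w) = z • s y w
  balanced : ∀ y d w, s (E.rsmul y d) w = s y (G.lsmul d w)
  map_lsmul : ∀ c y w, F.lsmul c (s y w) = s (E.lsmul c y) w
  map_rsmul : ∀ y w l, F.rsmul (s y w) l = s y (G.rsmul w l)
  map_linn : ∀ y y' w w',
    F.linn (s y w) (s y' w') = E.linn (E.rsmul y (G.linn w w')) y'
  map_rinn : ∀ y y' w w',
    F.rinn (s y w) (s y' w') = G.rinn w (G.lsmul (E.rinn y y') w')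
  dense : Dense (Submodule.span ℂ {v : V | ∃ y w, v = s y w} : Set V)

/-- A realization of the product of two elements of `Equi(A, C)`:
the tensor product bimodule together with the distinguished subspace `X₁ ⊗ X₂`. -/
structure IsPairTensor {A C Y W V : Type*}
    [NonUnitalCStarAlgebra C] [PartialOrder C] [StarOrderedRing C]
    [NormedAddCommGroup Y] [NormedSpace ℂ Y] [CompleteSpace Y]
    [NormedAddCommGroup W] [NormedSpace ℂ W] [CompleteSpace W]
    [NormedAddCommGroup V] [NormedSpace ℂ V] [CompleteSpace V]
    (ι : A → C)
    (E₁ : EquivBimodule C C Y) (X₁ : Submodule ℂ Y)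
    (E₂ : EquivBimodule C C W) (X₂ : Submodule ℂ W)
    (G : EquivBimodule C C V) (XV : Submodule ℂ V) (s : Y → W → V) : Prop where
  tensor : IsTensorProd E₁ E₂ G s
  sub : (XV : Set V) =
    closure (Submodule.span ℂ {v : V | ∃ x ∈ X₁, ∃ z ∈ X₂, v = s x z} : Set V)

section Multiplier

variable {C : Type*} [NonUnitalCStarAlgebra C]

/-- Conjugation `c ↦ u c u*` by a (unitary) multiplier `u ∈ M(C)`. -/
def mAd (u : 𝓜(ℂ, C)) (c : C) : C := u.fst ((star u).snd c)

/-- `m ∈ M(C)` is (the extension of) a multiplier of the subalgebra `A` (realized by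
`ι : A → C`): it maps `A` into `A` on both sides.  When `AC` is dense in `C`, the
multiplier algebra `M(A)` is exactly the set of such multipliers. -/
def IsMultiplierOf {A : Type*} (ι : A → C) (m : 𝓜(ℂ, C)) : Prop :=
  (∀ a : A, m.fst (ι a) ∈ Set.range ι) ∧ (∀ a : A, m.snd (ι a) ∈ Set.range ι)

/-- `u ∈ K(M(C))`: a unitary multiplier with `u a u*, u* a u ∈ A` for all `a ∈ A`. -/
def mem_KMC {A : Type*} (ι : A → C) (u : 𝓜(ℂ, C)) : Prop :=
  u ∈ unitary 𝓜(ℂ, C) ∧ (∀ a : A, mAd u (ι a) ∈ Set.range ι) ∧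
    (∀ a : A, mAd (star u) (ι a) ∈ Set.range ι)

/-- The subspace `Au = {a u | a ∈ A}` of `C`, for a multiplier `u ∈ M(C)`. -/
def AuSub {A : Type*} (ι : A → C) (u : 𝓜(ℂ, C)) : Submodule ℂ C :=
  Submodule.span ℂ {x : C | ∃ a : A, x = u.snd (ι a)}

end Multiplier

/-- A positive element `h` with `hA` dense in `A`; a C*-algebra is σ-unital iff it
possesses such a (strictly positive) element. -/
def SigmaUnital (A : Type*) [NonUnitalCStarAlgebra A] [PartialOrder A]
    [StarOrderedRing A] : Prop :=
  ∃ h : A, 0 ≤ h ∧ Dense (Set.range fun a : A => h * a)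

/-- A system of matrix units over `C` realizing `Cs` as the stabilization `C ⊗ K`. -/
structure IsStabilization {C Cs : Type*} [NonUnitalCStarAlgebra C]
    [NonUnitalCStarAlgebra Cs] (e : ℕ → ℕ → C → Cs) : Prop where
  map_add : ∀ i j c c', e i j (c + c') = e i j c + e i j c'
  map_smul : ∀ i j (z : ℂ) c, e i j (z • c) = z • e i j c
  map_mul : ∀ i j k l c d, e i j c * e k l d = if j = k then e i l (c * d) else 0
  map_star : ∀ i j c, star (e i j c) = e j i (star c)
  isometry : ∀ i j c, ‖e i j c‖ = ‖c‖
  dense : Dense (Submodule.span ℂ {x : Cs | ∃ i j c, x = e i j c} : Set Cs)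

section Unital

variable {A B C D : Type*} [CStarAlgebra A] [CStarAlgebra B] [CStarAlgebra C] [CStarAlgebra D]
  [PartialOrder C] [StarOrderedRing C] [PartialOrder D] [StarOrderedRing D]

/-- A conditional expectation from `C` onto `A`, for a unital inclusion realized by
`ι : A →⋆ₐ[ℂ] C`. -/
structure CondExpectation [PartialOrder A] [StarOrderedRing A] (ι : A →⋆ₐ[ℂ] C) where
  toFun : C → A
  map_add : ∀ x y, toFun (x + y) = toFun x + toFun y
  map_smul : ∀ (z : ℂ) x, toFun (z • x) = z • toFun x
  map_star : ∀ x, toFun (star x) = star (toFun x)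
  retraction : ∀ a, toFun (ι a) = a
  left_mod : ∀ a c, toFun (ι a * c) = a * toFun c
  right_mod : ∀ c a, toFun (c * ι a) = toFun c * a
  pos : ∀ c, 0 ≤ toFun (star c * c)

/-- A quasi-basis for a conditional expectation, in the sense of Watatani. -/
def IsQuasiBasis [PartialOrder A] [StarOrderedRing A] {ι : A →⋆ₐ[ℂ] C}
    (E : CondExpectation ι) {n : ℕ} (u : Fin n → C) : Prop :=
  ∀ c : C, (∑ i, u i * ι (E.toFun (star (u i) * c)) = c) ∧
    (∑ i, ι (E.toFun (c * u i)) * star (u i) = c)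

/-- A conditional expectation is of Watatani index-finite type if it admits a
quasi-basis. -/
def FiniteIndex [PartialOrder A] [StarOrderedRing A] {ι : A →⋆ₐ[ℂ] C}
    (E : CondExpectation ι) : Prop :=
  ∃ (n : ℕ) (u : Fin n → C), IsQuasiBasis E u

/-- `A' ∩ C = ℂ 1` for the inclusion realized by `ι`. -/
def IrreducibleIncl (ι : A →⋆ₐ[ℂ] C) : Prop :=
  ∀ c : C, (∀ a : A, ι a * c = c * ι a) → ∃ z : ℂ, c = z • (1 : C)

variable [PartialOrder A] [StarOrderedRing A] [PartialOrder B] [StarOrderedRing B]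

/-- A conditional expectation `E^X : Y → X` with respect to `E^A` and `E^B`
(Definition 2.4 of [KT4]). -/
structure IsBimodCondExp {Y : Type*}
    [NormedAddCommGroup Y] [NormedSpace ℂ Y] [CompleteSpace Y]
    (ιA : A →⋆ₐ[ℂ] C) (ιB : B →⋆ₐ[ℂ] D)
    (EA : CondExpectation ιA) (EB : CondExpectation ιB)
    (EY : EquivBimodule C D Y) (X : Submodule ℂ Y) (EX : Y → Y) : Prop where
  map_add : ∀ y y', EX (y + y') = EX y + EX y'
  map_smul : ∀ (z : ℂ) y, EX (z • y) = z • EX y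
  mem : ∀ y, EX y ∈ X
  cond1 : ∀ (c : C), ∀ x ∈ X, EX (EY.lsmul c x) = EY.lsmul (ιA (EA.toFun c)) x
  cond2 : ∀ (a : A) (y : Y), EX (EY.lsmul (ιA a) y) = EY.lsmul (ιA a) (EX y)
  cond3 : ∀ (y : Y), ∀ x ∈ X, ιA (EA.toFun (EY.linn y x)) = EY.linn (EX y) x
  cond4 : ∀ (d : D), ∀ x ∈ X, EX (EY.rsmul x d) = EY.rsmul x (ιB (EB.toFun d))
  cond5 : ∀ (b : B) (y : Y), EX (EY.rsmul y (ιB b)) = EY.rsmul (EX y) (ιB b)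
  cond6 : ∀ (y : Y), ∀ x ∈ X, ιB (EB.toFun (EY.rinn y x)) = EY.rinn (EX y) x

/-- The C*-basic construction `C₁` for a conditional expectation `E : C → A`,
realized by a unital embedding `ιC : C →⋆ₐ[ℂ] C₁` and the Jones projection `e`. -/
structure IsBasicConstruction {A C C₁ : Type*} [CStarAlgebra A] [CStarAlgebra C]
    [CStarAlgebra C₁] [PartialOrder A] [StarOrderedRing A]
    [PartialOrder C] [StarOrderedRing C]
    (ι : A →⋆ₐ[ℂ] C) (E : CondExpectation ι)
    (ιC : C →⋆ₐ[ℂ] C₁) (e : C₁) : Prop where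
  inj : Function.Injective ιC
  idem : e * e = e
  selfadj : star e = e
  comm : ∀ a : A, ιC (ι a) * e = e * ιC (ι a)
  expect : ∀ c : C, e * ιC c * e = ιC (ι (E.toFun c)) * e
  faithful : ∀ c : C, ιC c * e = 0 → c = 0
  span : ∀ x : C₁, x ∈ Submodule.span ℂ {z : C₁ | ∃ c d : C, z = ιC c * e * ιC d}

end Unital

/-- `M` is the `A–B`-equivalence bimodule obtained by restricting the operations of the
`C–D`-equivalence bimodule `EY` to the closed subspace `X` (whose inner products on `X`
take values in the subalgebras realized by `ιA`, `ιB`). -/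
structure IsRestriction {A B C D Y : Type*}
    [NonUnitalCStarAlgebra A] [PartialOrder A] [StarOrderedRing A]
    [NonUnitalCStarAlgebra B] [PartialOrder B] [StarOrderedRing B]
    [NonUnitalCStarAlgebra C] [PartialOrder C] [StarOrderedRing C]
    [NonUnitalCStarAlgebra D] [PartialOrder D] [StarOrderedRing D]
    [NormedAddCommGroup Y] [NormedSpace ℂ Y] [CompleteSpace Y]
    (ιA : A → C) (ιB : B → D)
    (EY : EquivBimodule C D Y) (X : Submodule ℂ Y) [CompleteSpace X]
    (M : EquivBimodule A B X) : Prop where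
  lsmul_coe : ∀ (a : A) (x : X), (M.lsmul a x : Y) = EY.lsmul (ιA a) (x : Y)
  rsmul_coe : ∀ (x : X) (b : B), (M.rsmul x b : Y) = EY.rsmul (x : Y) (ιB b)
  linn_coe : ∀ x y : X, ιA (M.linn x y) = EY.linn (x : Y) (y : Y)
  rinn_coe : ∀ x y : X, ιB (M.rinn x y) = EY.rinn (x : Y) (y : Y)

section Upward

variable {A B C D C₁ D₁ : Type*} [CStarAlgebra A] [CStarAlgebra B] [CStarAlgebra C]
  [CStarAlgebra D] [CStarAlgebra C₁] [CStarAlgebra D₁]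
  [PartialOrder A] [StarOrderedRing A] [PartialOrder B] [StarOrderedRing B]
  [PartialOrder C] [StarOrderedRing C] [PartialOrder D] [StarOrderedRing D]
  [PartialOrder C₁] [StarOrderedRing C₁] [PartialOrder D₁] [StarOrderedRing D₁]

/-- A realization of the upward basic construction `C ⊗_A X ⊗_B D̃` as a
`C₁–D₁`-equivalence bimodule, where `M` is the middle `A–B`-equivalence bimodule
(`X` regarded as an `A–B`-bimodule), together with the canonical trilinear map `t`
(the map `(c, x, d) ↦ c ⊗ x ⊗ d̃`, conjugate-linear in the last variable). -/
structure IsUpwardBasic {Xc T : Type*}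
    [NormedAddCommGroup Xc] [NormedSpace ℂ Xc] [CompleteSpace Xc]
    [NormedAddCommGroup T] [NormedSpace ℂ T] [CompleteSpace T]
    (ιA : A →⋆ₐ[ℂ] C) (ιB : B →⋆ₐ[ℂ] D)
    (EA : CondExpectation ιA) (EB : CondExpectation ιB)
    (M : EquivBimodule A B Xc)
    (ιC : C →⋆ₐ[ℂ] C₁) (eA : C₁) (ιD : D →⋆ₐ[ℂ] D₁) (eB : D₁)
    (F : EquivBimodule C₁ D₁ T) (t : C → Xc → D → T) : Prop where
  add₁ : ∀ c c' x d, t (c + c') x d = t c x d + t c' x d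
  smul₁ : ∀ (z : ℂ) c x d, t (z • c) x d = z • t c x d
  add₂ : ∀ c x x' d, t c (x + x') d = t c x d + t c x' d
  smul₂ : ∀ (z : ℂ) c x d, t c (z • x) d = z • t c x d
  add₃ : ∀ c x d d', t c x (d + d') = t c x d + t c x d'
  smul₃ : ∀ (z : ℂ) c x d, t c x (z • d) = (starRingEnd ℂ z) • t c x d
  balanced₁ : ∀ (a : A) c x d, t (c * ιA a) x d = t c (M.lsmul a x) d
  balanced₂ : ∀ (b : B) c x d, t c (M.rsmul x b) d = t c x (d * ιB (star b))
  map_lsmul : ∀ c' c x d, F.lsmul (ιC c') (t c x d) = t (c' * c) x d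
  map_eA : ∀ c x d, F.lsmul eA (t c x d) = t (ιA (EA.toFun c)) x d
  map_rsmul : ∀ c x d d', F.rsmul (t c x d) (ιD d') = t c x (star d' * d)
  map_eB : ∀ c x d, F.rsmul (t c x d) eB = t c x (ιB (EB.toFun d))
  linn_eq : ∀ c c' x x' d d',
    F.linn (t c x d) (t c' x' d') =
      ιC (c * ιA (M.linn (M.rsmul x (EB.toFun (star d * d'))) x')) * eA * ιC (star c')
  rinn_eq : ∀ c c' x x' d d',
    F.rinn (t c x d) (t c' x' d') =
      ιD d * eB * ιD (ιB (M.rinn x (M.lsmul (EA.toFun (star c * c')) x')) * star d')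
  dense : Dense (Submodule.span ℂ {v : T | ∃ c x d, v = t c x d} : Set T)

end Upward



section Helpers
open Filter Topology

namespace EquivBimodule

section Basic
variable {C D Y : Type*}
    [NonUnitalCStarAlgebra C] [PartialOrder C] [StarOrderedRing C]
    [NonUnitalCStarAlgebra D] [PartialOrder D] [StarOrderedRing D]
    [NormedAddCommGroup Y] [NormedSpace ℂ Y] [CompleteSpace Y]
    (E : EquivBimodule C D Y)

lemma linn_add_right (x y z : Y) : E.linn x (y + z) = E.linn x y + E.linn x z := by
  rw [← E.linn_star, E.linn_add_left, star_add, E.linn_star, E.linn_star]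

lemma linn_smul_right (t : ℂ) (x y : Y) : E.linn x (t • y) = star t • E.linn x y := by
  rw [← E.linn_star, E.linn_smul_left, star_smul, E.linn_star]

lemma linn_lsmul_right (c : C) (x y : Y) : E.linn x (E.lsmul c y) = E.linn x y * star c := by
  rw [← E.linn_star, E.linn_lsmul_left, star_mul, E.linn_star]

lemma rinn_add_left (x y z : Y) : E.rinn (x + y) z = E.rinn x z + E.rinn y z := by
  rw [← E.rinn_star, E.rinn_add_right, star_add, E.rinn_star, E.rinn_star]

lemma rinn_smul_left (t : ℂ) (x y : Y) : E.rinn (t • x) y = star t • E.rinn x y := by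
  rw [← E.rinn_star, E.rinn_smul_right, star_smul, E.rinn_star]

lemma rinn_rsmul_left (x y : Y) (d : D) : E.rinn (E.rsmul x d) y = star d * E.rinn x y := by
  rw [← E.rinn_star, E.rinn_rsmul_right, star_mul, E.rinn_star]

/-- A bound on a sesquilinear map from a bound on the diagonal. -/
lemma _root_.sesq_bound {Y N : Type*} [NormedAddCommGroup Y] [NormedSpace ℂ Y]
    [NormedAddCommGroup N] [NormedSpace ℂ N] (f : Y → Y → N)
    (hal : ∀ x y z, f (x + y) z = f x z + f y z)
    (har : ∀ x y z, f x (y + z) = f x y + f x z)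
    (hsl : ∀ (t : ℂ) x y, f (t • x) y = t • f x y)
    (hsr : ∀ (t : ℂ) x y, f x (t • y) = star t • f x y)
    (hn : ∀ x, ‖f x x‖ = ‖x‖ ^ 2) (x y : Y) : ‖f x y‖ ≤ 4 * ‖x‖ * ‖y‖ := by
  have key : ∀ x y : Y, ‖x‖ ≤ 1 → ‖y‖ ≤ 1 → ‖f x y‖ ≤ 4 := by
    intro x y hx hy
    have h4 : (4 : ℂ) • f x y = f (x + y) (x + y) - f (x + (-1 : ℂ) • y) (x + (-1 : ℂ) • y)
        + Complex.I • f (x + Complex.I • y) (x + Complex.I • y)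
        - Complex.I • f (x + (-Complex.I) • y) (x + (-Complex.I) • y) := by
      simp only [hal, har, hsl, hsr, smul_add, smul_smul]
      simp only [Complex.star_def, Complex.conj_I, map_neg, map_one, neg_neg, mul_neg, neg_mul,
        Complex.I_mul_I, neg_smul, one_smul, mul_one]
      module
    have hb : ∀ t : ℂ, ‖t‖ = 1 → ‖f (x + t • y) (x + t • y)‖ ≤ 4 := by
      intro t ht
      rw [hn]
      have : ‖x + t • y‖ ≤ 2 := by
        calc _ ≤ ‖x‖ + ‖t • y‖ := norm_add_le _ _
          _ ≤ 2 := by rw [norm_smul, ht]; linarith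
      nlinarith [norm_nonneg (x + t • y)]
    have h1 := hb 1 (by simp)
    have h2 := hb (-1) (by simp)
    have h3 := hb Complex.I (by simp)
    have h5 := hb (-Complex.I) (by simp)
    rw [one_smul] at h1
    have : ‖(4 : ℂ) • f x y‖ ≤ 16 := by
      rw [h4]
      refine (norm_sub_le _ _).trans ?_
      refine (add_le_add_left (norm_add_le _ _) _).trans ?_
      refine (add_le_add_left (add_le_add_left (norm_sub_le _ _) _) _).trans ?_
      rw [norm_smul, norm_smul, Complex.norm_I]
      linarith
    rw [norm_smul] at this
    norm_num at this
    linarith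
  by_cases hx : x = 0
  · have : f 0 y = 0 := by simpa using hsl 0 0 y
    simp [hx, this]
  by_cases hy : y = 0
  · have : f x 0 = 0 := by simpa using hsr 0 x 0
    simp [hy, this]
  have hx' : 0 < ‖x‖ := norm_pos_iff.2 hx
  have hy' : 0 < ‖y‖ := norm_pos_iff.2 hy
  have := key (((‖x‖⁻¹ : ℝ) : ℂ) • x) (((‖y‖⁻¹ : ℝ) : ℂ) • y)
    (by rw [norm_smul]; simp [hx'.ne']) (by rw [norm_smul]; simp [hy'.ne'])
  rw [hsl, hsr, norm_smul, norm_smul, norm_star] at this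
  simp only [Complex.norm_real, norm_inv, norm_norm] at this
  rw [← mul_assoc, ← mul_inv, inv_mul_le_iff₀ (by positivity)] at this
  linarith

lemma norm_linn_le (x y : Y) : ‖E.linn x y‖ ≤ 4 * ‖x‖ * ‖y‖ :=
  sesq_bound E.linn E.linn_add_left E.linn_add_right E.linn_smul_left E.linn_smul_right
    E.norm_linn x y

lemma norm_rinn_le (x y : Y) : ‖E.rinn x y‖ ≤ 4 * ‖x‖ * ‖y‖ := by
  have := sesq_bound (fun x y => E.rinn y x) (fun x y z => E.rinn_add_right _ _ _)
    (fun x y z => E.rinn_add_left _ _ _) (fun t x y => E.rinn_smul_right _ _ _)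
    (fun t x y => E.rinn_smul_left _ _ _) E.norm_rinn y x
  linarith

/-- continuity of a function of one variable from additivity and a bound -/
lemma _root_.cont_of_bound {Y N : Type*} [NormedAddCommGroup Y] [NormedAddCommGroup N]
    (f : Y → N) (h : ∀ x y, f (x + y) = f x + f y) (K : ℝ) (hK : ∀ x, ‖f x‖ ≤ K * ‖x‖) :
    Continuous f :=
  AddMonoidHomClass.continuous_of_bound (AddMonoidHom.mk' f h) K hK

lemma norm_lsmul_le (c : C) (x : Y) : ‖E.lsmul c x‖ ≤ ‖c‖ * ‖x‖ := by
  have h : ‖E.lsmul c x‖ ^ 2 ≤ (‖c‖ * ‖x‖) ^ 2 := by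
    rw [← E.norm_linn, E.linn_lsmul_left, E.linn_lsmul_right]
    calc _ ≤ ‖c‖ * (‖E.linn x x‖ * ‖star c‖) := by
          refine (norm_mul_le _ _).trans ?_
          gcongr
          exact norm_mul_le _ _
      _ = _ := by rw [norm_star, E.norm_linn]; ring
  exact (sq_le_sq₀ (by positivity) (by positivity)).1 h

lemma norm_rsmul_le (x : Y) (d : D) : ‖E.rsmul x d‖ ≤ ‖x‖ * ‖d‖ := by
  have h : ‖E.rsmul x d‖ ^ 2 ≤ (‖x‖ * ‖d‖) ^ 2 := by
    rw [← E.norm_rinn, E.rinn_rsmul_left, E.rinn_rsmul_right]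
    calc _ ≤ ‖star d‖ * (‖E.rinn x x‖ * ‖d‖) := by
          refine (norm_mul_le _ _).trans ?_
          gcongr
          exact norm_mul_le _ _
      _ = _ := by rw [norm_star, E.norm_rinn]; ring
  exact (sq_le_sq₀ (by positivity) (by positivity)).1 h

lemma cont_linn_left (y : Y) : Continuous (fun x => E.linn x y) :=
  cont_of_bound _ (fun _ _ => E.linn_add_left _ _ _) (4 * ‖y‖)
    (fun x => (E.norm_linn_le x y).trans (by linarith))
lemma cont_linn_right (x : Y) : Continuous (fun y => E.linn x y) :=
  cont_of_bound _ (fun _ _ => E.linn_add_right _ _ _) (4 * ‖x‖)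
    (fun y => (E.norm_linn_le x y))
lemma cont_rinn_left (y : Y) : Continuous (fun x => E.rinn x y) :=
  cont_of_bound _ (fun _ _ => E.rinn_add_left _ _ _) (4 * ‖y‖)
    (fun x => (E.norm_rinn_le x y).trans (by linarith))
lemma cont_rinn_right (x : Y) : Continuous (fun y => E.rinn x y) :=
  cont_of_bound _ (fun _ _ => E.rinn_add_right _ _ _) (4 * ‖x‖)
    (fun y => (E.norm_rinn_le x y))
lemma cont_lsmul_left (y : Y) : Continuous (fun c => E.lsmul c y) :=
  cont_of_bound _ (fun _ _ => E.add_lsmul _ _ _) ‖y‖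
    (fun c => (E.norm_lsmul_le c y).trans (by linarith))
lemma cont_lsmul_right (c : C) : Continuous (fun y => E.lsmul c y) :=
  cont_of_bound _ (fun _ _ => E.lsmul_add _ _ _) ‖c‖
    (fun y => (E.norm_lsmul_le c y))
lemma cont_rsmul_left (d : D) : Continuous (fun y => E.rsmul y d) :=
  cont_of_bound _ (fun _ _ => E.add_rsmul _ _ _) ‖d‖
    (fun y => (E.norm_rsmul_le y d).trans (by linarith))
lemma cont_rsmul_right (y : Y) : Continuous (fun d => E.rsmul y d) :=
  cont_of_bound _ (fun _ _ => E.rsmul_add _ _ _) ‖y‖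
    (fun d => (E.norm_rsmul_le y d))

lemma neg_lsmul (c : C) (x : Y) : E.lsmul (-c) x = - E.lsmul c x := by
  have := E.smul_lsmul (-1) c x
  simpa using this
lemma sub_lsmul (c d : C) (x : Y) : E.lsmul (c - d) x = E.lsmul c x - E.lsmul d x := by
  rw [sub_eq_add_neg, E.add_lsmul, E.neg_lsmul, sub_eq_add_neg]
lemma rsmul_neg (x : Y) (c : D) : E.rsmul x (-c) = - E.rsmul x c := by
  have := E.smul_rsmul (-1) x c
  simpa using this
lemma rsmul_sub (x : Y) (c d : D) : E.rsmul x (c - d) = E.rsmul x c - E.rsmul x d := by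
  rw [sub_eq_add_neg, E.rsmul_add, E.rsmul_neg, sub_eq_add_neg]
lemma linn_sub_left (x y z : Y) : E.linn (x - y) z = E.linn x z - E.linn y z := by
  have := E.linn_add_left (x - y) y z
  rw [sub_add_cancel] at this
  rw [this, add_sub_cancel_right]
lemma linn_sub_right (x y z : Y) : E.linn x (y - z) = E.linn x y - E.linn x z := by
  have := E.linn_add_right x (y - z) z
  rw [sub_add_cancel] at this
  rw [this, add_sub_cancel_right]
lemma rinn_sub_left (x y z : Y) : E.rinn (x - y) z = E.rinn x z - E.rinn y z := by
  have := E.rinn_add_left (x - y) y z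
  rw [sub_add_cancel] at this
  rw [this, add_sub_cancel_right]
lemma rinn_sub_right (x y z : Y) : E.rinn x (y - z) = E.rinn x y - E.rinn x z := by
  have := E.rinn_add_right x (y - z) z
  rw [sub_add_cancel] at this
  rw [this, add_sub_cancel_right]

lemma eq_of_linn {x y : Y} (h : ∀ z, E.linn x z = E.linn y z) : x = y := by
  rw [← sub_eq_zero]
  apply E.linn_definite
  rw [E.linn_sub_left, h, sub_self]

/-- the left action is faithful -/
lemma lsmul_faithful {c c' : C} (h : ∀ y, E.lsmul c y = E.lsmul c' y) : c = c' := by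
  have h1 : ∀ b : C, (c - c') * b = 0 := by
    have hcl : IsClosed {b : C | (c - c') * b = 0} :=
      isClosed_eq (by fun_prop) continuous_const
    intro b
    have : (Submodule.span ℂ {c : C | ∃ x y, c = E.linn x y} : Set C) ⊆
        {b : C | (c - c') * b = 0} := by
      intro b hb
      induction hb using Submodule.span_induction with
      | mem b hb =>
        obtain ⟨x, y, rfl⟩ := hb
        show (c - c') * E.linn x y = 0
        rw [← E.linn_lsmul_left, E.sub_lsmul, h, sub_self]
        simpa using E.linn_smul_left 0 0 y
      | zero => simp
      | add a b _ _ ha hb =>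
        show (c - c') * (a + b) = 0
        rw [mul_add, show _ = _ from ha, show _ = _ from hb, add_zero]
      | smul t a _ ha =>
        show (c - c') * (t • a) = 0
        rw [mul_smul_comm, show _ = _ from ha, smul_zero]
    have := closure_minimal this hcl (E.full_left.closure_eq ▸ Set.mem_univ b)
    exact this
  have := h1 (star (c - c'))
  rw [CStarRing.mul_star_self_eq_zero_iff] at this
  exact sub_eq_zero.1 this

lemma rsmul_faithful {d d' : D} (h : ∀ y, E.rsmul y d = E.rsmul y d') : d = d' := by
  have h1 : ∀ b : D, b * (d - d') = 0 := by
    have hcl : IsClosed {b : D | b * (d - d') = 0} :=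
      isClosed_eq (by fun_prop) continuous_const
    intro b
    have : (Submodule.span ℂ {c : D | ∃ x y, c = E.rinn x y} : Set D) ⊆
        {b : D | b * (d - d') = 0} := by
      intro b hb
      induction hb using Submodule.span_induction with
      | mem b hb =>
        obtain ⟨x, y, rfl⟩ := hb
        show E.rinn x y * (d - d') = 0
        rw [← E.rinn_rsmul_right, E.rsmul_sub, h, sub_self]
        simpa using E.rinn_smul_right 0 x 0
      | zero => simp
      | add a b _ _ ha hb =>
        show (a + b) * (d - d') = 0
        rw [add_mul, show _ = _ from ha, show _ = _ from hb, add_zero]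
      | smul t a _ ha =>
        show (t • a) * (d - d') = 0
        rw [smul_mul_assoc, show _ = _ from ha, smul_zero]
    have := closure_minimal this hcl (E.full_right.closure_eq ▸ Set.mem_univ b)
    exact this
  have := h1 (star (d - d'))
  rw [CStarRing.star_mul_self_eq_zero_iff] at this
  exact sub_eq_zero.1 this

lemma linn_rsmul (x y : Y) (d : D) : E.linn (E.rsmul x (star d)) y = E.linn x (E.rsmul y d) := by
  apply E.lsmul_faithful
  intro w
  rw [E.imprimitivity, E.imprimitivity, ← E.rsmul_mul, E.rinn_rsmul_left]

lemma rinn_lsmul (x y : Y) (c : C) : E.rinn (E.lsmul (star c) x) y = E.rinn x (E.lsmul c y) := by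
  apply E.rsmul_faithful
  intro w
  rw [← E.imprimitivity, ← E.imprimitivity, E.linn_lsmul_right, star_star, E.mul_lsmul]

/-- `‖s p s*‖` estimates -/
lemma norm_rsmul_star_sq_le (x : Y) (s : D) (hs : ‖s‖ ≤ 1) :
    ‖E.rsmul x (star s)‖ ^ 2 ≤ ‖E.rinn x x * star s‖ := by
  rw [← E.norm_rinn, E.rinn_rsmul_left, E.rinn_rsmul_right, star_star]
  refine (norm_mul_le _ _).trans ?_
  exact mul_le_of_le_one_left (norm_nonneg _) hs

lemma norm_lsmul_sq_le (x : Y) (s : C) (hs : ‖s‖ ≤ 1) :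
    ‖E.lsmul s x‖ ^ 2 ≤ ‖E.linn x x * star s‖ := by
  rw [← E.norm_linn, E.linn_lsmul_left, E.linn_lsmul_right]
  refine (norm_mul_le _ _).trans ?_
  exact mul_le_of_le_one_left (norm_nonneg _) hs

lemma norm_sub_rsmul_sq_le (x : Y) (k : D) (hk : ‖k‖ ≤ 1) (hks : star k = k) :
    ‖E.rsmul x k - x‖ ^ 2 ≤ 2 * ‖E.rinn x x * k - E.rinn x x‖ := by
  rw [← E.norm_rinn, E.rinn_sub_left, E.rinn_sub_right, E.rinn_sub_right, E.rinn_rsmul_left,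
    E.rinn_rsmul_right, E.rinn_rsmul_left, hks, ← mul_sub]
  refine (norm_sub_le _ _).trans ?_
  have := (norm_mul_le k (E.rinn x x * k - E.rinn x x)).trans
    (mul_le_of_le_one_left (norm_nonneg _) hk)
  linarith

lemma norm_sub_lsmul_sq_le (x : Y) (k : C) (hk : ‖k‖ ≤ 1) (hks : star k = k) :
    ‖E.lsmul k x - x‖ ^ 2 ≤ 2 * ‖E.linn x x * k - E.linn x x‖ := by
  rw [← E.norm_linn, E.linn_sub_left, E.linn_sub_right, E.linn_sub_right, E.linn_lsmul_left,
    E.linn_lsmul_right, E.linn_lsmul_left, hks, ← mul_sub]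
  refine (norm_sub_le _ _).trans ?_
  have := (norm_mul_le k (E.linn x x * k - E.linn x x)).trans
    (mul_le_of_le_one_left (norm_nonneg _) hk)
  linarith

end Basic
end EquivBimodule

/-- an isometric relation with dense projections gives a linear isometric isomorphism -/
lemma exists_isom {V W : Type*} [NormedAddCommGroup V] [NormedSpace ℂ V] [CompleteSpace V]
    [NormedAddCommGroup W] [NormedSpace ℂ W] [CompleteSpace W]
    (R : Submodule ℂ (V × W)) (h : ∀ p ∈ R, ‖p.1‖ = ‖p.2‖)
    (h1 : Dense (Prod.fst '' (R : Set (V × W)))) (h2 : Dense (Prod.snd '' (R : Set (V × W)))) :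
    ∃ Φ : V ≃ₗᵢ[ℂ] W, ∀ p ∈ R, Φ p.1 = p.2 := by
  have hK : ∀ p ∈ R.topologicalClosure, ‖p.1‖ = ‖p.2‖ := by
    intro p hp
    have : IsClosed {p : V × W | ‖p.1‖ = ‖p.2‖} := isClosed_eq (by fun_prop) (by fun_prop)
    exact closure_minimal (fun p hp => h p hp) this hp
  have hc : IsClosed (R.topologicalClosure : Set (V × W)) := R.isClosed_topologicalClosure
  have : CompleteSpace R.topologicalClosure := hc.completeSpace_coe
  let f : R.topologicalClosure →ₗᵢ[ℂ] V :=
    { toLinearMap := (LinearMap.fst ℂ V W).comp R.topologicalClosure.subtype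
      norm_map' := by
        rintro ⟨p, hp⟩
        show ‖p.1‖ = ‖p‖
        rw [Prod.norm_def, ← hK p hp, max_self] }
  let g : R.topologicalClosure →ₗᵢ[ℂ] W :=
    { toLinearMap := (LinearMap.snd ℂ V W).comp R.topologicalClosure.subtype
      norm_map' := by
        rintro ⟨p, hp⟩
        show ‖p.2‖ = ‖p‖
        rw [Prod.norm_def, hK p hp, max_self] }
  have hf : Function.Surjective f := by
    have hcl : IsClosed (Set.range f) := f.isometry.isClosedEmbedding.isClosed_range
    have hd : Dense (Set.range f) := h1.mono (by
      rintro _ ⟨p, hp, rfl⟩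
      exact ⟨⟨p, R.le_topologicalClosure hp⟩, rfl⟩)
    rw [← Set.range_eq_univ, ← hcl.closure_eq, hd.closure_eq]
  have hg : Function.Surjective g := by
    have hcl : IsClosed (Set.range g) := g.isometry.isClosedEmbedding.isClosed_range
    have hd : Dense (Set.range g) := h2.mono (by
      rintro _ ⟨p, hp, rfl⟩
      exact ⟨⟨p, R.le_topologicalClosure hp⟩, rfl⟩)
    rw [← Set.range_eq_univ, ← hcl.closure_eq, hd.closure_eq]
  let f' := LinearIsometryEquiv.ofSurjective f hf
  let g' := LinearIsometryEquiv.ofSurjective g hg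
  refine ⟨f'.symm.trans g', fun p hp => ?_⟩
  have : f'.symm p.1 = ⟨p, R.le_topologicalClosure hp⟩ := by
    rw [LinearIsometryEquiv.symm_apply_eq]; rfl
  show g' (f'.symm p.1) = p.2
  rw [this]; rfl


/-- an approximate unit `s s*` of `C` inside `S`, with `s` shifting to infinity -/
structure ShiftData {Cs I : Type*} [NonUnitalCStarAlgebra Cs] (S : Set Cs) (l : Filter I)
    (s : I → Cs) : Prop where
  mem : ∀ i, s i ∈ S
  norm_le : ∀ᶠ i in l, ‖s i‖ ≤ 1
  tend0 : ∀ c, Tendsto (fun i => c * star (s i)) l (𝓝 0)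
  tend1 : ∀ c, Tendsto (fun i => c * (s i * star (s i))) l (𝓝 c)

lemma tend_closure {Cs I : Type*} [NonUnitalCStarAlgebra Cs] {l : Filter I}
    (f : I → Cs) (hf : ∀ᶠ i in l, ‖f i‖ ≤ 1) (t : ℂ) (ht : ‖t‖ ≤ 1) (G : Set Cs)
    (hG : ∀ g ∈ G, Tendsto (fun i => g * f i) l (𝓝 (t • g))) :
    ∀ c ∈ closure (Submodule.span ℂ G : Set Cs), Tendsto (fun i => c * f i) l (𝓝 (t • c)) := by
  have hs : ∀ g ∈ Submodule.span ℂ G, Tendsto (fun i => g * f i) l (𝓝 (t • g)) := by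
    intro g hg
    induction hg using Submodule.span_induction with
    | mem g hg => exact hG g hg
    | zero => simpa using tendsto_const_nhds
    | add a b _ _ ha hb => simpa [add_mul] using ha.add hb
    | smul z a _ ha =>
      have := ha.const_smul z
      simpa [smul_mul_assoc, smul_comm z t a] using this
  intro c hc
  rw [Metric.tendsto_nhds]
  intro ε hε
  obtain ⟨g, hg, hcg⟩ := Metric.mem_closure_iff.1 hc (ε / 4) (by positivity)
  rw [dist_eq_norm] at hcg
  filter_upwards [hf, (Metric.tendsto_nhds.1 (hs g hg)) (ε / 4) (by positivity)] with i h1 h2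
  rw [dist_eq_norm] at h2 ⊢
  have e1 : c * f i - t • c = (c - g) * f i + (g * f i - t • g) - t • (c - g) := by
    rw [sub_mul, smul_sub]; abel
  rw [e1]
  have a1 : ‖(c - g) * f i‖ ≤ ε / 4 :=
    (norm_mul_le _ _).trans ((mul_le_of_le_one_right (norm_nonneg _) h1).trans hcg.le)
  have a2 : ‖t • (c - g)‖ ≤ ε / 4 := by
    rw [norm_smul]
    exact (mul_le_of_le_one_left (norm_nonneg _) ht).trans hcg.le
  calc _ ≤ ‖(c - g) * f i + (g * f i - t • g)‖ + ‖t • (c - g)‖ := norm_sub_le _ _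
    _ ≤ ‖(c - g) * f i‖ + ‖g * f i - t • g‖ + ‖t • (c - g)‖ := by gcongr; exact norm_add_le _ _
    _ < ε := by linarith

lemma DenseIncl.right {A C : Type*} [NonUnitalCStarAlgebra A] [NonUnitalCStarAlgebra C]
    (ι : A →⋆ₙₐ[ℂ] C)
    (h : DenseIncl ⇑ι) :
    Dense (Submodule.span ℂ {x : C | ∃ (c : C) (a : A), x = c * ι a} : Set C) := by
  intro x
  have h1 := h (star x)
  have h2 : x ∈ star '' closure
      (Submodule.span ℂ {x : C | ∃ (a : A) (c : C), x = ι a * c} : Set C) :=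
    ⟨star x, h1, star_star x⟩
  have h3 := image_closure_subset_closure_image continuous_star h2
  refine closure_mono ?_ h3
  rintro _ ⟨y, hy, rfl⟩
  induction hy using Submodule.span_induction with
  | mem g hg =>
    obtain ⟨a, c, rfl⟩ := hg
    exact Submodule.subset_span ⟨star c, star a, by rw [star_mul, map_star]⟩
  | zero => rw [star_zero]; exact Submodule.zero_mem _
  | add a b _ _ ha hb => rw [star_add]; exact Submodule.add_mem _ ha hb
  | smul z a _ ha => rw [star_smul]; exact Submodule.smul_mem _ _ ha

section shift
variable {A C As Cs : Type*}
    [NonUnitalCStarAlgebra A] [PartialOrder A] [StarOrderedRing A]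
    [NonUnitalCStarAlgebra C]
    [NonUnitalCStarAlgebra As]
    [NonUnitalCStarAlgebra Cs]

/-- the diagonal embedding -/
def diagHom (e : ℕ → ℕ → C → Cs) (hstab : IsStabilization e) (N : ℕ) : C →⋆ₙₐ[ℂ] Cs where
  toFun c := ∑ k ∈ Finset.range N, e k k c
  map_smul' z c := by simp [hstab.map_smul, Finset.smul_sum]
  map_zero' := by
    have : ∀ k, e k k 0 = 0 := fun k => by simpa using hstab.map_smul k k 0 0
    simp [this]
  map_add' x y := by simp [hstab.map_add, Finset.sum_add_distrib]
  map_mul' x y := by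
    rw [Finset.sum_mul]
    refine Finset.sum_congr rfl fun k hk => ?_
    rw [Finset.mul_sum, Finset.sum_eq_single_of_mem k hk]
    · rw [hstab.map_mul, if_pos rfl]
    · intro j _ hj
      rw [hstab.map_mul, if_neg (Ne.symm hj)]
  map_star' x := by
    rw [star_sum]
    exact Finset.sum_congr rfl fun k _ => (hstab.map_star k k x).symm

/-- the shift elements -/
def shiftEl (e : ℕ → ℕ → C → Cs) (ι : A → C) (p : ℕ × A) : Cs :=
  ∑ k ∈ Finset.range p.1, e k (p.1 + k) (ι p.2)

lemma shiftEl_mul_star (e : ℕ → ℕ → C → Cs) (hstab : IsStabilization e) (ι : A →⋆ₙₐ[ℂ] C)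
    (p : ℕ × A) : shiftEl e ι p * star (shiftEl e ι p) =
      diagHom e hstab p.1 (ι (p.2 * star p.2)) := by
  show _ = ∑ k ∈ Finset.range p.1, e k k (ι (p.2 * star p.2))
  rw [shiftEl, Finset.sum_mul]
  refine Finset.sum_congr rfl fun k hk => ?_
  rw [star_sum, Finset.mul_sum, Finset.sum_eq_single_of_mem k hk]
  · rw [hstab.map_star, hstab.map_mul, if_pos rfl, map_mul, map_star]
  · intro j _ hj
    rw [hstab.map_star, hstab.map_mul, if_neg (by omega)]

theorem exists_shift (ι : A →⋆ₙₐ[ℂ] C)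
    (e : ℕ → ℕ → C → Cs) (hstab : IsStabilization e)
    (ιs : As →⋆ₙₐ[ℂ] Cs) (hds : DenseIncl ⇑ιs)
    (hAs : Set.range ⇑ιs =
      closure (Submodule.span ℂ {x : Cs | ∃ i j a, x = e i j (ι a)} : Set Cs)) :
    ∃ l : Filter (ℕ × A), l.NeBot ∧ ShiftData (Set.range ⇑ιs) l (shiftEl e ι) := by
  refine ⟨atTop ×ˢ CStarAlgebra.approximateUnit A, inferInstance, ?_⟩
  have hu := CStarAlgebra.increasingApproximateUnit A
  have hunorm : ∀ᶠ p : ℕ × A in atTop ×ˢ CStarAlgebra.approximateUnit A, ‖p.2‖ ≤ 1 :=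
    tendsto_snd.eventually hu.eventually_norm
  have hnorm2 : ∀ᶠ p : ℕ × A in atTop ×ˢ CStarAlgebra.approximateUnit A,
      ‖shiftEl e ι p * star (shiftEl e ι p)‖ ≤ 1 := by
    filter_upwards [hunorm] with p hp
    rw [shiftEl_mul_star e hstab]
    refine (NonUnitalStarAlgHom.norm_apply_le _ _).trans ?_
    refine (NonUnitalStarAlgHom.norm_apply_le _ _).trans ?_
    rw [CStarRing.norm_self_mul_star]
    exact mul_le_one₀ hp (norm_nonneg _) hp
  have hnorm : ∀ᶠ p : ℕ × A in atTop ×ˢ CStarAlgebra.approximateUnit A,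
      ‖shiftEl e ι p‖ ≤ 1 := by
    filter_upwards [hnorm2] with p hp
    rw [CStarRing.norm_self_mul_star] at hp
    nlinarith [norm_nonneg (shiftEl e ι p)]
  have hnorm' : ∀ᶠ p : ℕ × A in atTop ×ˢ CStarAlgebra.approximateUnit A,
      ‖star (shiftEl e ι p)‖ ≤ 1 := by simpa only [norm_star] using hnorm
  have hN : ∀ j : ℕ, ∀ᶠ p : ℕ × A in atTop ×ˢ CStarAlgebra.approximateUnit A, j < p.1 :=
    fun j => tendsto_fst.eventually (eventually_gt_atTop j)
  have t0 : ∀ c ∈ Set.range ⇑ιs, Tendsto (fun p => c * star (shiftEl e ι p))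
      (atTop ×ˢ CStarAlgebra.approximateUnit A) (𝓝 ((0 : ℂ) • c)) := by
    rw [hAs]
    refine tend_closure _ hnorm' 0 (by simp) _ ?_
    rintro _ ⟨i, j, a, rfl⟩
    rw [zero_smul]
    refine Tendsto.congr' ?_ tendsto_const_nhds
    filter_upwards [hN j] with p hp
    rw [shiftEl, star_sum, Finset.mul_sum]
    refine (Finset.sum_eq_zero fun k _ => ?_).symm
    rw [hstab.map_star, hstab.map_mul, if_neg (by omega)]
  have t1 : ∀ c ∈ Set.range ⇑ιs, Tendsto
      (fun p => c * (shiftEl e ι p * star (shiftEl e ι p)))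
      (atTop ×ˢ CStarAlgebra.approximateUnit A) (𝓝 ((1 : ℂ) • c)) := by
    rw [hAs]
    refine tend_closure _ hnorm2 1 (by simp) _ ?_
    rintro _ ⟨i, j, a, rfl⟩
    rw [one_smul]
    have h1 : Tendsto (fun u : A => a * (u * star u)) (CStarAlgebra.approximateUnit A) (𝓝 a) := by
      have h2 : Tendsto (fun u : A => a * u * u) (CStarAlgebra.approximateUnit A) (𝓝 a) := by
        have h3 := hu.tendsto_mul_left a
        have h4 : Tendsto (fun u : A => (a * u - a) * u) (CStarAlgebra.approximateUnit A)
            (𝓝 0) := by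
          have h5 : Tendsto (fun u : A => a * u - a) (CStarAlgebra.approximateUnit A)
            (𝓝 0) := by simpa using h3.sub_const a
          rw [tendsto_zero_iff_norm_tendsto_zero] at h5 ⊢
          refine squeeze_zero' (Eventually.of_forall fun _ => norm_nonneg _) ?_ h5
          filter_upwards [hu.eventually_norm] with u hu
          exact (norm_mul_le _ _).trans (mul_le_of_le_one_right (norm_nonneg _) hu)
        have := h4.add h3
        simpa [sub_mul] using this
      refine h2.congr' ?_
      filter_upwards [hu.eventually_star_eq] with u hu
      rw [hu, mul_assoc]
    have hec : Continuous (fun a : A => e i j (ι a)) := by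
      refine cont_of_bound _ (fun x y => by rw [map_add, hstab.map_add]) 1 fun a => ?_
      rw [hstab.isometry, one_mul]
      exact NonUnitalStarAlgHom.norm_apply_le _ _
    have h2 := ((hec.tendsto a).comp h1).comp
      (tendsto_snd (f := (atTop : Filter ℕ)) (g := CStarAlgebra.approximateUnit A))
    refine h2.congr' ?_
    filter_upwards [hN j] with p hp
    rw [shiftEl_mul_star e hstab]
    show _ = _ * ∑ k ∈ Finset.range p.1, e k k (ι (p.2 * star p.2))
    rw [Finset.mul_sum, Finset.sum_eq_single_of_mem j (Finset.mem_range.2 hp)]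
    · rw [hstab.map_mul, if_pos rfl, ← map_mul]; rfl
    · intro k _ hk
      rw [hstab.map_mul, if_neg (Ne.symm hk)]
  have hr := DenseIncl.right ιs hds
  refine ⟨?_, hnorm, ?_, ?_⟩
  · intro p
    rw [hAs, shiftEl]
    refine subset_closure (Submodule.sum_mem _ fun k _ => Submodule.subset_span ⟨_, _, _, rfl⟩)
  · intro c
    have := tend_closure _ hnorm' 0 (by simp) {x | ∃ (c : Cs) (a : As), x = c * ιs a} ?_ c (hr c)
    · simpa using this
    · rintro _ ⟨c, a, rfl⟩
      have := (t0 (ιs a) ⟨a, rfl⟩).const_mul c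
      simpa [mul_assoc] using this
  · intro c
    have := tend_closure _ hnorm2 1 (by simp) {x | ∃ (c : Cs) (a : As), x = c * ιs a} ?_ c (hr c)
    · simpa using this
    · rintro _ ⟨c, a, rfl⟩
      have := (t1 (ιs a) ⟨a, rfl⟩).const_mul c
      simpa [mul_assoc] using this

end shift

/-- the genericity argument -/
lemma generic_open_dense {X N I : Type*} [NormedAddCommGroup X] [NormedSpace ℂ X]
    [NormedAddCommGroup N] [NormedSpace ℂ N] (f : X → X → N)
    (hal : ∀ x y z, f (x + y) z = f x z + f y z)
    (har : ∀ x y z, f x (y + z) = f x y + f x z)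
    (hsl : ∀ (t : ℂ) x y, f (t • x) y = t • f x y)
    (hsr : ∀ (t : ℂ) x y, f x (t • y) = star t • f x y)
    (hcl : ∀ y, Continuous fun x => f x y) (hcr : ∀ x, Continuous fun y => f x y)
    (l : Filter I) [l.NeBot] (P Q : I → X → X)
    (hPQ : ∀ i x y, f (P i x) y = f x (Q i y)) (hQP : ∀ i x y, f x (P i y) = f (Q i x) y)
    (hP : ∀ x, ∀ᶠ i in l, ‖P i x‖ ≤ ‖x‖)
    (hQ0 : ∀ x, Tendsto (fun i => Q i x) l (𝓝 0))
    (hQ1 : ∀ x, Tendsto (fun i => Q i (P i x)) l (𝓝 x))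
    (h : N) (hh : h ∈ closure (Submodule.span ℂ {n | ∃ x y, n = f x y} : Set N))
    (ε : ℝ) (hε : 0 < ε) :
    IsOpen {x | ∃ z, ‖f x z - h‖ < ε} ∧ Dense {x | ∃ z, ‖f x z - h‖ < ε} := by
  have f0l : ∀ y, f 0 y = 0 := fun y => by simpa using hsl 0 0 y
  have f0r : ∀ y, f y 0 = 0 := fun y => by simpa using hsr 0 y 0
  have hsp : (Submodule.span ℂ {n | ∃ x y, n = f x y} : Set N) ⊆
      closure {n | ∃ x y, n = f x y} := by
    intro n hn
    induction hn using Submodule.span_induction with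
    | mem n hn => exact subset_closure hn
    | zero => exact subset_closure ⟨0, 0, by rw [f0l]⟩
    | add a b _ _ ha hb =>
      rw [← closure_closure]
      refine map_mem_closure₂ continuous_add ha hb ?_
      rintro _ ⟨y₁, z₁, rfl⟩ _ ⟨y₂, z₂, rfl⟩
      have ht : Tendsto (fun i => f (y₁ + P i y₂) (z₁ + P i z₂)) l
          (𝓝 (f y₁ z₁ + f y₂ z₂)) := by
        have e1 : ∀ i, f (y₁ + P i y₂) (z₁ + P i z₂) =
            f y₁ z₁ + f (Q i y₁) z₂ + f y₂ (Q i z₁) + f (Q i (P i y₂)) z₂ := by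
          intro i
          rw [hal, har, har, hQP, hPQ, hQP]
          abel
        simp only [e1]
        have a1 : Tendsto (fun i => f (Q i y₁) z₂) l (𝓝 0) := by
          have := ((hcl z₂).tendsto 0).comp (hQ0 y₁)
          simpa [f0l, Function.comp_def] using this
        have a2 : Tendsto (fun i => f y₂ (Q i z₁)) l (𝓝 0) := by
          have := ((hcr y₂).tendsto 0).comp (hQ0 z₁)
          simpa [f0r, Function.comp_def] using this
        have a3 : Tendsto (fun i => f (Q i (P i y₂)) z₂) l (𝓝 (f y₂ z₂)) :=
          ((hcl z₂).tendsto y₂).comp (hQ1 y₂)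
        simpa using ((tendsto_const_nhds.add a1).add a2).add a3
      exact mem_closure_of_tendsto ht (Eventually.of_forall fun i => ⟨_, _, rfl⟩)
    | smul t a _ ha =>
      refine map_mem_closure (continuous_const_smul t) ha ?_
      rintro _ ⟨y, z, rfl⟩
      exact ⟨t • y, z, by rw [hsl]⟩
  have hh' : h ∈ closure {n | ∃ x y, n = f x y} := closure_minimal hsp isClosed_closure hh
  constructor
  · have : {x | ∃ z, ‖f x z - h‖ < ε} = ⋃ z, {x | ‖f x z - h‖ < ε} := by ext; simp
    rw [this]
    refine isOpen_iUnion fun z => isOpen_lt ?_ continuous_const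
    have := hcl z
    fun_prop
  · intro x₀
    rw [Metric.mem_closure_iff]
    intro η hη
    obtain ⟨_, ⟨y, z, rfl⟩, hyz⟩ := Metric.mem_closure_iff.1 hh' ε hε
    obtain ⟨δ, hδ, hδy⟩ : ∃ δ : ℝ, 0 < δ ∧ δ * ‖y‖ < η := by
      refine ⟨η / (2 * (‖y‖ + 1)), by positivity, ?_⟩
      rw [div_mul_eq_mul_div, div_lt_iff₀ (by positivity)]
      nlinarith [norm_nonneg y]
    have hδ' : (δ : ℂ) ≠ 0 := by exact_mod_cast hδ.ne'
    have ht : Tendsto (fun i => f (x₀ + (δ : ℂ) • P i y) ((δ : ℂ)⁻¹ • P i z)) l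
        (𝓝 (f y z)) := by
      have e1 : ∀ i, f (x₀ + (δ : ℂ) • P i y) ((δ : ℂ)⁻¹ • P i z) =
          (δ : ℂ)⁻¹ • f (Q i x₀) z + f (Q i (P i y)) z := by
        intro i
        rw [hal, hsl, hsr, hsr, hQP, hQP, smul_smul]
        simp [hδ']
      simp only [e1]
      have a1 : Tendsto (fun i => f (Q i x₀) z) l (𝓝 0) := by
        have := ((hcl z).tendsto 0).comp (hQ0 x₀)
        simpa [f0l, Function.comp_def] using this
      have a3 : Tendsto (fun i => f (Q i (P i y)) z) l (𝓝 (f y z)) :=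
        ((hcl z).tendsto y).comp (hQ1 y)
      simpa using (a1.const_smul ((δ : ℂ)⁻¹)).add a3
    have hev : ∀ᶠ i in l, ‖f (x₀ + (δ : ℂ) • P i y) ((δ : ℂ)⁻¹ • P i z) - h‖ < ε := by
      have hc : Tendsto (fun i => ‖f (x₀ + (δ : ℂ) • P i y) ((δ : ℂ)⁻¹ • P i z) - h‖) l
        (𝓝 ‖f y z - h‖) := (ht.sub_const h).norm
      refine hc.eventually (gt_mem_nhds ?_)
      rwa [← dist_eq_norm, dist_comm]
    obtain ⟨i, hi, hPi⟩ := (hev.and (hP y)).exists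
    refine ⟨_, ⟨_, hi⟩, ?_⟩
    rw [dist_eq_norm, sub_add_cancel_left, norm_neg, norm_smul, Complex.norm_real,
      Real.norm_of_nonneg hδ.le]
    exact lt_of_le_of_lt (by gcongr) hδy


/-- a countable family generating `B` as a one-sided ideal on each side -/
structure GenFam {Cs : Type*} [NonUnitalCStarAlgebra Cs] (B : Set Cs) (H : ℕ → Cs) : Prop where
  mem : ∀ k, H k ∈ B
  right : B ⊆ closure (Submodule.span ℂ {x : Cs | ∃ k, ∃ b ∈ B, x = H k * b} : Set Cs)
  left : B ⊆ closure (Submodule.span ℂ {x : Cs | ∃ k, ∃ b ∈ B, x = b * H k} : Set Cs)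

lemma closure_span_le {V : Type*} [NormedAddCommGroup V] [NormedSpace ℂ V] {G : Set V}
    {L : Submodule ℂ V} (h : G ⊆ closure (L : Set V)) :
    closure (Submodule.span ℂ G : Set V) ⊆ closure (L : Set V) := by
  have h1 : Submodule.span ℂ G ≤ L.topologicalClosure := by
    rw [Submodule.span_le, Submodule.topologicalClosure_coe]; exact h
  refine closure_minimal ?_ isClosed_closure
  intro x hx
  rw [← Submodule.topologicalClosure_coe]
  exact h1 hx

theorem exists_genFam {A C As Cs : Type*}
    [NonUnitalCStarAlgebra A] [PartialOrder A] [StarOrderedRing A]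
    [NonUnitalCStarAlgebra C]
    [NonUnitalCStarAlgebra As]
    [NonUnitalCStarAlgebra Cs]
    (ι : A →⋆ₙₐ[ℂ] C)
    (hσ : SigmaUnital A)
    (e : ℕ → ℕ → C → Cs) (hstab : IsStabilization e)
    (ιs : As →⋆ₙₐ[ℂ] Cs)
    (hAs : Set.range ⇑ιs =
      closure (Submodule.span ℂ {x : Cs | ∃ i j a, x = e i j (ι a)} : Set Cs)) :
    ∃ H, GenFam (Set.range ⇑ιs) H := by
  obtain ⟨h, h0, hh⟩ := hσ
  have hs : star h = h := (IsSelfAdjoint.of_nonneg h0).star_eq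
  have hec : ∀ i j, Continuous (fun a : A => e i j (ι a)) := by
    intro i j
    refine cont_of_bound _ (fun x y => by rw [map_add, hstab.map_add]) 1 fun a => ?_
    rw [hstab.isometry, one_mul]
    exact NonUnitalStarAlgHom.norm_apply_le _ _
  have hm : ∀ i j a, e i j (ι a) ∈ Set.range ⇑ιs := by
    intro i j a
    rw [hAs]; exact subset_closure (Submodule.subset_span ⟨i, j, a, rfl⟩)
  have hh' : Dense (Set.range fun a : A => a * h) := by
    intro x
    have h2 : x ∈ star '' closure (Set.range fun a : A => h * a) :=
      ⟨star x, hh _, star_star x⟩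
    refine closure_mono ?_ (image_closure_subset_closure_image continuous_star h2)
    rintro _ ⟨_, ⟨a, rfl⟩, rfl⟩
    exact ⟨star a, by simp [hs]⟩
  refine ⟨fun k => e k k (ι h), fun k => hm _ _ _, ?_, ?_⟩
  · nth_rw 1 [hAs]
    apply closure_span_le
    rintro _ ⟨i, j, a, rfl⟩
    have := map_mem_closure (hec i j) (hh a) (t := {x | ∃ b, x = e i j (ι (h * b))})
      (by rintro _ ⟨b, rfl⟩; exact ⟨b, rfl⟩)
    refine closure_mono ?_ this
    rintro _ ⟨b, rfl⟩
    refine Submodule.subset_span ⟨i, e i j (ι b), hm _ _ _, ?_⟩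
    rw [hstab.map_mul, if_pos rfl, map_mul]
  · nth_rw 1 [hAs]
    apply closure_span_le
    rintro _ ⟨i, j, a, rfl⟩
    have := map_mem_closure (hec i j) (hh' a) (t := {x | ∃ b, x = e i j (ι (b * h))})
      (by rintro _ ⟨b, rfl⟩; exact ⟨b, rfl⟩)
    refine closure_mono ?_ this
    rintro _ ⟨b, rfl⟩
    refine Submodule.subset_span ⟨j, e i j (ι b), hm _ _ _, ?_⟩
    rw [hstab.map_mul, if_pos rfl, map_mul]

section generic
variable {As Cs I Y : Type*}
    [NonUnitalCStarAlgebra As]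
    [NonUnitalCStarAlgebra Cs] [PartialOrder Cs] [StarOrderedRing Cs]
    [NormedAddCommGroup Y] [NormedSpace ℂ Y] [CompleteSpace Y]

lemma ShiftData.kappa_norm {Cs I : Type*} [NonUnitalCStarAlgebra Cs] {S : Set Cs} {l : Filter I}
    {s : I → Cs} (h : ShiftData S l s) : ∀ᶠ i in l, ‖s i * star (s i)‖ ≤ 1 := by
  filter_upwards [h.norm_le] with i hi
  rw [CStarRing.norm_self_mul_star]
  exact mul_le_one₀ hi (norm_nonneg _) hi

lemma ShiftData.kappa_star {Cs I : Type*} [NonUnitalCStarAlgebra Cs] {S : Set Cs} {l : Filter I}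
    {s : I → Cs} (_h : ShiftData S l s) (i) : star (s i * star (s i)) = s i * star (s i) := by
  simp

lemma ShiftData.tend2 {Cs I : Type*} [NonUnitalCStarAlgebra Cs] {S : Set Cs} {l : Filter I}
    {s : I → Cs} (h : ShiftData S l s) (c : Cs) :
    Tendsto (fun i => (s i * star (s i)) * c) l (𝓝 c) := by
  have := (continuous_star.tendsto _).comp (h.tend1 (star c))
  simpa [Function.comp_def, mul_assoc] using this

variable {S : Set Cs} {l : Filter I} {s : I → Cs}
  (F : EquivBimodule Cs Cs Y)

lemma tendsto_of_sq {f : I → Y} {g : I → Cs} (hb : ∀ᶠ i in l, ‖f i‖ ^ 2 ≤ 2 * ‖g i‖)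
    (hg : Tendsto g l (𝓝 0)) : Tendsto f l (𝓝 0) := by
  rw [tendsto_zero_iff_norm_tendsto_zero] at hg ⊢
  have h1 : Tendsto (fun i => ‖f i‖ ^ 2) l (𝓝 0) :=
    squeeze_zero' (Eventually.of_forall fun _ => by positivity) hb (by simpa using hg.const_mul 2)
  have h2 := (Real.continuous_sqrt.tendsto 0).comp h1
  simpa [Function.comp_def] using h2

lemma ShiftData.rsmul0 (h : ShiftData S l s) (x : Y) : Tendsto (fun i => F.rsmul x (star (s i))) l (𝓝 0) := by
  refine tendsto_of_sq ?_ (h.tend0 (F.rinn x x))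
  filter_upwards [h.norm_le] with i hi
  have := F.norm_rsmul_star_sq_le x (s i) hi
  linarith [norm_nonneg (F.rinn x x * star (s i))]

lemma ShiftData.lsmul0 (h : ShiftData S l s) (x : Y) : Tendsto (fun i => F.lsmul (s i) x) l (𝓝 0) := by
  refine tendsto_of_sq ?_ (h.tend0 (F.linn x x))
  filter_upwards [h.norm_le] with i hi
  have := F.norm_lsmul_sq_le x (s i) hi
  linarith [norm_nonneg (F.linn x x * star (s i))]

lemma ShiftData.rsmul1 (h : ShiftData S l s) (x : Y) : Tendsto (fun i => F.rsmul x (s i * star (s i))) l (𝓝 x) := by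
  rw [← tendsto_sub_nhds_zero_iff]
  refine tendsto_of_sq (g := fun i => F.rinn x x * (s i * star (s i)) - F.rinn x x) ?_ ?_
  · filter_upwards [h.kappa_norm] with i hi
    exact F.norm_sub_rsmul_sq_le x _ hi (h.kappa_star i)
  · simpa using (h.tend1 (F.rinn x x)).sub_const (F.rinn x x)

lemma ShiftData.lsmul1 (h : ShiftData S l s) (x : Y) : Tendsto (fun i => F.lsmul (s i * star (s i)) x) l (𝓝 x) := by
  rw [← tendsto_sub_nhds_zero_iff]
  refine tendsto_of_sq (g := fun i => F.linn x x * (s i * star (s i)) - F.linn x x) ?_ ?_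
  · filter_upwards [h.kappa_norm] with i hi
    exact F.norm_sub_lsmul_sq_le x _ hi (h.kappa_star i)
  · simpa using (h.tend1 (F.linn x x)).sub_const (F.linn x x)

end generic

lemma linn_zero_left {C D Y : Type*}
    [NonUnitalCStarAlgebra C] [PartialOrder C] [StarOrderedRing C]
    [NonUnitalCStarAlgebra D] [PartialOrder D] [StarOrderedRing D]
    [NormedAddCommGroup Y] [NormedSpace ℂ Y] [CompleteSpace Y]
    (E : EquivBimodule C D Y) (x : Y) : E.linn 0 x = 0 := by
  simpa using E.linn_smul_left 0 0 x

section gen2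
variable {As Cs I Y : Type*}
    [NonUnitalCStarAlgebra As]
    [NonUnitalCStarAlgebra Cs] [PartialOrder Cs] [StarOrderedRing Cs]
    [NormedAddCommGroup Y] [NormedSpace ℂ Y] [CompleteSpace Y]
    {l : Filter I} [l.NeBot] {s : I → Cs}

theorem exists_generic (ιs : As →⋆ₙₐ[ℂ] Cs) (h : ShiftData (Set.range ⇑ιs) l s) (H : ℕ → Cs)
    (hH : GenFam (Set.range ⇑ιs) H) (F : EquivBimodule Cs Cs Y) (X : Submodule ℂ Y)
    (hF : IsEquiPair ⇑ιs F X) :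
    ∃ x ∈ X, Set.range ⇑ιs ⊆ closure {c | ∃ y ∈ X, c = F.linn x y} ∧
      Set.range ⇑ιs ⊆ closure {c | ∃ y ∈ X, c = F.rinn y x} := by
  have : CompleteSpace X := hF.closed.completeSpace_coe
  have hsX : ∀ i, ∀ x ∈ X, F.rsmul x (s i) ∈ X := fun i x hx => by
    obtain ⟨a, ha⟩ := h.mem i; rw [← ha]; exact hF.rsmul_mem a x hx
  have hsX' : ∀ i, ∀ x ∈ X, F.rsmul x (star (s i)) ∈ X := fun i x hx => by
    obtain ⟨a, ha⟩ := h.mem i; rw [← ha, ← map_star]; exact hF.rsmul_mem _ x hx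
  have hXs : ∀ i, ∀ x ∈ X, F.lsmul (s i) x ∈ X := fun i x hx => by
    obtain ⟨a, ha⟩ := h.mem i; rw [← ha]; exact hF.lsmul_mem a x hx
  have hXs' : ∀ i, ∀ x ∈ X, F.lsmul (star (s i)) x ∈ X := fun i x hx => by
    obtain ⟨a, ha⟩ := h.mem i; rw [← ha, ← map_star]; exact hF.lsmul_mem _ x hx
  have key1 : ∀ (k m : ℕ), IsOpen {x : X | ∃ z : X, ‖F.linn x z - H k‖ < 1 / ((m : ℝ) + 1)} ∧
      Dense {x : X | ∃ z : X, ‖F.linn x z - H k‖ < 1 / ((m : ℝ) + 1)} := by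
    intro k m
    refine generic_open_dense (X := X) (N := Cs) (fun x y => F.linn x y)
      (fun x y z => F.linn_add_left _ _ _) (fun x y z => F.linn_add_right _ _ _)
      (fun t x y => F.linn_smul_left _ _ _) (fun t x y => F.linn_smul_right _ _ _)
      (fun y => (F.cont_linn_left y).comp continuous_subtype_val)
      (fun y => (F.cont_linn_right y).comp continuous_subtype_val) l
      (fun i x => ⟨F.rsmul x (s i), hsX i x x.2⟩)
      (fun i x => ⟨F.rsmul x (star (s i)), hsX' i x x.2⟩) ?_ ?_ ?_ ?_ ?_ _ ?_ _ (by positivity)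
    · intro i x y
      simpa using F.linn_rsmul x y (star (s i))
    · intro i x y
      exact (F.linn_rsmul x y (s i)).symm
    · intro x
      filter_upwards [h.norm_le] with i hi
      exact (F.norm_rsmul_le _ _).trans (mul_le_of_le_one_right (norm_nonneg _) hi)
    · intro x
      rw [tendsto_subtype_rng]
      exact h.rsmul0 F x
    · intro x
      rw [tendsto_subtype_rng]
      simpa [F.rsmul_mul] using h.rsmul1 F x
    · have := hH.mem k
      rw [← hF.span_XX_left] at this
      have e1 : {n | ∃ x y : X, n = F.linn x y} = {c | ∃ x ∈ X, ∃ y ∈ X, c = F.linn x y} := by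
        ext c
        simp only [Subtype.exists, exists_prop, Set.mem_setOf_eq]
      rw [e1]; exact this
  have key2 : ∀ (k m : ℕ), IsOpen {x : X | ∃ z : X, ‖F.rinn z x - H k‖ < 1 / ((m : ℝ) + 1)} ∧
      Dense {x : X | ∃ z : X, ‖F.rinn z x - H k‖ < 1 / ((m : ℝ) + 1)} := by
    intro k m
    refine generic_open_dense (X := X) (N := Cs) (fun x y => F.rinn y x)
      (fun x y z => F.rinn_add_right _ _ _) (fun x y z => F.rinn_add_left _ _ _)
      (fun t x y => F.rinn_smul_right _ _ _) (fun t x y => F.rinn_smul_left _ _ _)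
      (fun y => (F.cont_rinn_right y).comp continuous_subtype_val)
      (fun y => (F.cont_rinn_left y).comp continuous_subtype_val) l
      (fun i x => ⟨F.lsmul (star (s i)) x, hXs' i x x.2⟩)
      (fun i x => ⟨F.lsmul (s i) x, hXs i x x.2⟩) ?_ ?_ ?_ ?_ ?_ _ ?_ _ (by positivity)
    · intro i x y
      simpa using (F.rinn_lsmul y x (star (s i))).symm
    · intro i x y
      exact (F.rinn_lsmul y x (s i))
    · intro x
      filter_upwards [h.norm_le] with i hi
      rw [← norm_star] at hi
      exact (F.norm_lsmul_le _ _).trans (mul_le_of_le_one_left (norm_nonneg _) hi)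
    · intro x
      rw [tendsto_subtype_rng]
      exact h.lsmul0 F x
    · intro x
      rw [tendsto_subtype_rng]
      simpa [F.mul_lsmul] using h.lsmul1 F x
    · have := hH.mem k
      rw [← hF.span_XX_right] at this
      have e1 : {n | ∃ x y : X, n = F.rinn y x} = {c | ∃ x ∈ X, ∃ y ∈ X, c = F.rinn x y} := by
        ext c
        simp only [Subtype.exists, exists_prop, Set.mem_setOf_eq]
        constructor
        · rintro ⟨a, ha, b, hb, e⟩; exact ⟨b, hb, a, ha, e⟩
        · rintro ⟨a, ha, b, hb, e⟩; exact ⟨b, hb, a, ha, e⟩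
      rw [e1]; exact this
  have hd := dense_iInter_of_isOpen (ι := (ℕ × ℕ) ⊕ (ℕ × ℕ)) (X := X)
    (f := Sum.elim (fun p => {x : X | ∃ z : X, ‖F.linn x z - H p.1‖ < 1 / ((p.2 : ℝ) + 1)})
      (fun p => {x : X | ∃ z : X, ‖F.rinn z x - H p.1‖ < 1 / ((p.2 : ℝ) + 1)}))
    (by rintro (p | p); exacts [(key1 _ _).1, (key2 _ _).1])
    (by rintro (p | p); exacts [(key1 _ _).2, (key2 _ _).2])
  obtain ⟨x, hx⟩ := hd.nonempty
  rw [Set.mem_iInter] at hx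
  have hx1 : ∀ k, H k ∈ closure {c | ∃ y ∈ X, c = F.linn x y} := by
    intro k
    rw [Metric.mem_closure_iff]
    intro ε hε
    obtain ⟨m, hm⟩ := exists_nat_one_div_lt hε
    obtain ⟨z, hz⟩ := hx (Sum.inl (k, m))
    refine ⟨_, ⟨z, z.2, rfl⟩, ?_⟩
    rw [dist_comm, dist_eq_norm]; exact hz.trans hm
  have hx2 : ∀ k, H k ∈ closure {c | ∃ y ∈ X, c = F.rinn y x} := by
    intro k
    rw [Metric.mem_closure_iff]
    intro ε hε
    obtain ⟨m, hm⟩ := exists_nat_one_div_lt hε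
    obtain ⟨z, hz⟩ := hx (Sum.inr (k, m))
    refine ⟨_, ⟨z, z.2, rfl⟩, ?_⟩
    rw [dist_comm, dist_eq_norm]; exact hz.trans hm
  refine ⟨x, x.2, ?_, ?_⟩
  · let L : Submodule ℂ Cs :=
      { carrier := {c | ∃ y ∈ X, c = F.linn x y}
        zero_mem' := ⟨0, X.zero_mem, by simpa using (F.linn_smul_right 0 x 0).symm⟩
        add_mem' := by
          rintro _ _ ⟨y, hy, rfl⟩ ⟨z, hz, rfl⟩
          exact ⟨y + z, X.add_mem hy hz, (F.linn_add_right _ _ _).symm⟩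
        smul_mem' := by
          rintro t _ ⟨y, hy, rfl⟩
          exact ⟨star t • y, X.smul_mem _ hy, by rw [F.linn_smul_right, star_star]⟩ }
    refine hH.right.trans (closure_span_le (L := L) ?_)
    rintro _ ⟨k, _, ⟨b, rfl⟩, rfl⟩
    refine map_mem_closure (f := fun c => c * ιs b) (by fun_prop) (hx1 k) ?_
    rintro _ ⟨y, hy, rfl⟩
    exact ⟨F.lsmul (ιs (star b)) y, hF.lsmul_mem _ _ hy, by
      rw [F.linn_lsmul_right, map_star, star_star]⟩
  · let L : Submodule ℂ Cs :=
      { carrier := {c | ∃ y ∈ X, c = F.rinn y x}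
        zero_mem' := ⟨0, X.zero_mem, by simpa using (F.rinn_smul_left 0 0 x).symm⟩
        add_mem' := by
          rintro _ _ ⟨y, hy, rfl⟩ ⟨z, hz, rfl⟩
          exact ⟨y + z, X.add_mem hy hz, (F.rinn_add_left _ _ _).symm⟩
        smul_mem' := by
          rintro t _ ⟨y, hy, rfl⟩
          exact ⟨star t • y, X.smul_mem _ hy, by rw [F.rinn_smul_left, star_star]⟩ }
    refine hH.left.trans (closure_span_le (L := L) ?_)
    rintro _ ⟨k, _, ⟨b, rfl⟩, rfl⟩
    refine map_mem_closure (f := fun c => ιs b * c) (by fun_prop) (hx2 k) ?_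
    rintro _ ⟨y, hy, rfl⟩
    exact ⟨F.rsmul y (ιs (star b)), hF.rsmul_mem _ _ hy, by
      rw [F.rinn_rsmul_left, map_star, star_star]⟩

end gen2

section sqrt
variable {Cs : Type*} [NonUnitalCStarAlgebra Cs] [PartialOrder Cs] [StarOrderedRing Cs]

lemma sqrt_data (B : NonUnitalStarSubalgebra ℂ Cs) (hB : IsClosed (B : Set Cs)) (p : Cs)
    (hpB : p ∈ B) (hp : 0 ≤ p) :
    ∃ r ∈ B, star r = r ∧ r * r = p ∧ ∃ g : ℕ → Cs, (∀ n, g n ∈ B) ∧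
      ∀ n : ℕ, star (r * g n) = r * g n ∧
        ‖p - (r * g n) * p - p * (r * g n) + (r * g n) * p * (r * g n)‖ ≤ 1 / ((n : ℝ) + 1) := by
  have hsa : IsSelfAdjoint p := .of_nonneg hp
  have hpos : ∀ t ∈ quasispectrum ℝ p, 0 ≤ t := quasispectrum_nonneg_of_nonneg p hp
  let g : ℕ → ℝ → ℝ := fun n t => ((n : ℝ) + 1) * √t / (1 + ((n : ℝ) + 1) * |t|)
  have hgc : ∀ n, Continuous (g n) := by
    intro n
    refine Continuous.div (by fun_prop) (by fun_prop) fun t => ?_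
    positivity
  have hg0 : ∀ n, g n 0 = 0 := fun n => by simp [g]
  have hrp : cfcₙ (fun t : ℝ => √t) p * cfcₙ (fun t : ℝ => √t) p = p := by
    rw [← cfcₙ_mul (fun t : ℝ => √t) (fun t : ℝ => √t) p]
    refine Eq.trans ?_ (cfcₙ_id' ℝ p)
    exact cfcₙ_congr fun t ht => Real.mul_self_sqrt (hpos t ht)
  refine ⟨cfcₙ (fun t : ℝ => √t) p, cfcₙ_mem (𝕜' := ℂ) _ hpB,
    (cfcₙ_predicate (fun t : ℝ => √t) p : IsSelfAdjoint _).star_eq, hrp,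
    fun n => cfcₙ (g n) p, fun n => cfcₙ_mem (𝕜' := ℂ) _ hpB, fun n => ?_⟩
  have hgn := hgc n
  have hf : cfcₙ (fun t : ℝ => √t) p * cfcₙ (g n) p = cfcₙ (fun t => √t * g n t) p := by
    rw [cfcₙ_mul (fun t : ℝ => √t) (g n) p (by fun_prop) (by simp) (by fun_prop) (hg0 n)]
  rw [hf]
  set f : ℝ → ℝ := fun t => √t * g n t with hfdef
  have hfc : Continuous f := by fun_prop
  have hf0 : f 0 = 0 := by simp [hfdef]
  refine ⟨(cfcₙ_predicate f p : IsSelfAdjoint _).star_eq, ?_⟩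
  have h1 : p - cfcₙ f p * p - p * cfcₙ f p + cfcₙ f p * p * cfcₙ f p =
      cfcₙ (fun t => t - f t * t - t * f t + f t * t * f t) p := by
    rw [cfcₙ_add (a := p) (fun t => t - f t * t - t * f t) (fun t => f t * t * f t)
        (by fun_prop) (by simp [hf0]) (by fun_prop) (by simp [hf0]),
      cfcₙ_sub (fun t => t - f t * t) (fun t => t * f t) p
        (by fun_prop) (by simp [hf0]) (by fun_prop) (by simp [hf0]),
      cfcₙ_sub (fun t => t) (fun t => f t * t) p
        (by fun_prop) (by simp [hf0]) (by fun_prop) (by simp [hf0]),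
      cfcₙ_mul (fun t => f t * t) f p
        (by fun_prop) (by simp [hf0]) (by fun_prop) (by simp [hf0]),
      cfcₙ_mul (fun t => t) f p
        (by fun_prop) (by simp) (by fun_prop) (by simp [hf0]),
      cfcₙ_mul f (fun t => t) p
        (by fun_prop) (by simp [hf0]) (by fun_prop) (by simp),
      cfcₙ_id' ℝ p]
  rw [h1]
  refine norm_cfcₙ_le fun t ht => ?_
  have ht0 := hpos t ht
  have hN : (0 : ℝ) < (n : ℝ) + 1 := by positivity
  have hft : f t = ((n : ℝ) + 1) * t / (1 + ((n : ℝ) + 1) * t) := by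
    simp only [hfdef, g, abs_of_nonneg ht0]
    rw [← mul_div_assoc]
    congr 1
    have := Real.mul_self_sqrt ht0
    linear_combination ((n : ℝ) + 1) * this
  generalize (n : ℝ) + 1 = N at hft hN ⊢
  have hD : 0 < 1 + N * t := by positivity
  have e : t - f t * t - t * f t + f t * t * f t = t / (1 + N * t) ^ 2 := by
    rw [hft]; field_simp; ring
  rw [e, Real.norm_of_nonneg (by positivity), div_le_div_iff₀ (by positivity) hN]
  nlinarith [mul_nonneg hN.le ht0, mul_nonneg (mul_nonneg hN.le ht0) (mul_nonneg hN.le ht0)]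

end sqrt

section core
variable {As Cs I Y : Type*}
    [NonUnitalCStarAlgebra As]
    [NonUnitalCStarAlgebra Cs] [PartialOrder Cs] [StarOrderedRing Cs]
    [NormedAddCommGroup Y] [NormedSpace ℂ Y] [CompleteSpace Y]
    {l : Filter I} {s : I → Cs}

lemma ShiftData.kappa_mem {ιs : As →⋆ₙₐ[ℂ] Cs} (h : ShiftData (Set.range ⇑ιs) l s) (i : I) :
    s i * star (s i) ∈ Set.range ⇑ιs := by
  obtain ⟨a, ha⟩ := h.mem i
  exact ⟨a * star a, by rw [map_mul, map_star, ha]⟩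

theorem core_iso [l.NeBot] (ιs : As →⋆ₙₐ[ℂ] Cs) (hcl : IsClosed (Set.range ⇑ιs))
    (h : ShiftData (Set.range ⇑ιs) l s)
    (F : EquivBimodule Cs Cs Y) (X : Submodule ℂ Y)
    (hF : IsEquiPair ⇑ιs F X) (x : Y) (hx : x ∈ X)
    (hx1 : Set.range ⇑ιs ⊆ closure {c | ∃ y ∈ X, c = F.linn x y})
    (hx2 : Set.range ⇑ιs ⊆ closure {c | ∃ y ∈ X, c = F.rinn y x}) :
    ∃ Φ : Y ≃ₗᵢ[ℂ] Cs, (∀ y z, Φ y * star (Φ z) = F.linn y z) ∧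
      (∀ c y, Φ (F.lsmul c y) = c * Φ y) ∧ Φ '' (X : Set Y) = Set.range ⇑ιs := by
  obtain ⟨r, hrB, hrs, hrp, g, hg, hgf⟩ := sqrt_data (NonUnitalStarAlgHom.range ιs)
    (by simpa using hcl) (F.linn x x) (by simpa using hF.linn_mem x hx x hx) (F.linn_nonneg x)
  have hrB' : r ∈ Set.range ⇑ιs := by simpa using hrB
  have hg' : ∀ n, g n ∈ Set.range ⇑ιs := fun n => by simpa using hg n
  -- `A x` dense in `X`, `C x` dense in `Y`
  have dX : (X : Set Y) ⊆ closure {y | ∃ a, y = F.lsmul (ιs a) x} := by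
    intro y hy
    refine isClosed_closure.mem_of_tendsto (h.rsmul1 F y) (Eventually.of_forall fun i => ?_)
    refine map_mem_closure (F.cont_rsmul_right y) (hx2 (h.kappa_mem i)) ?_
    rintro _ ⟨z, hz, rfl⟩
    obtain ⟨a, ha⟩ := hF.linn_mem y hy z hz
    exact ⟨a, by rw [ha, F.imprimitivity]⟩
  have dY : Dense {y | ∃ c, y = F.lsmul c x} := by
    intro y
    refine isClosed_closure.mem_of_tendsto (h.rsmul1 F y) (Eventually.of_forall fun i => ?_)
    refine map_mem_closure (F.cont_rsmul_right y) (hx2 (h.kappa_mem i)) ?_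
    rintro _ ⟨z, hz, rfl⟩
    exact ⟨F.linn y z, by rw [F.imprimitivity]⟩
  -- `f_n x → x`
  have hfx : Tendsto (fun n => F.lsmul (r * g n) x) atTop (𝓝 x) := by
    rw [← tendsto_sub_nhds_zero_iff, tendsto_zero_iff_norm_tendsto_zero]
    have h1 : Tendsto (fun n => ‖F.lsmul (r * g n) x - x‖ ^ 2) atTop (𝓝 0) := by
      refine squeeze_zero (fun _ => by positivity) (fun n => ?_)
        tendsto_one_div_add_atTop_nhds_zero_nat
      rw [← F.norm_linn, F.linn_sub_left, F.linn_sub_right, F.linn_sub_right,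
        F.linn_lsmul_left, F.linn_lsmul_left, F.linn_lsmul_right]
      rw [(hgf n).1]
      refine le_of_eq_of_le ?_ (hgf n).2
      congr 1
      rw [mul_assoc (r * g n)]
      abel
    have h2 := (Real.continuous_sqrt.tendsto 0).comp h1
    simpa [Function.comp_def] using h2
  have dA' : Set.range ⇑ιs ⊆ closure {c | ∃ a, c = r * ιs a} := by
    refine hx1.trans (closure_minimal ?_ isClosed_closure)
    rintro _ ⟨y, hy, rfl⟩
    refine isClosed_closure.mem_of_tendsto (((F.cont_linn_left y).tendsto x).comp hfx)
      (Eventually.of_forall fun n => subset_closure ?_)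
    obtain ⟨a, ha⟩ := hF.linn_mem x hx y hy
    obtain ⟨b, hb⟩ := hg' n
    refine ⟨b * a, ?_⟩
    simp only [Function.comp]
    rw [F.linn_lsmul_left, map_mul, ha, hb, mul_assoc]
  have dA : Set.range ⇑ιs ⊆ closure {c | ∃ a, c = ιs a * r} := by
    rintro _ ⟨a, rfl⟩
    have := map_mem_closure continuous_star (dA' ⟨star a, rfl⟩) (t := {c | ∃ a, c = ιs a * r}) ?_
    · simpa [map_star] using this
    · rintro _ ⟨b, rfl⟩
      exact ⟨star b, by simp [map_star, hrs]⟩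
  have dC : Dense {c | ∃ d, c = d * r} := by
    intro c
    refine isClosed_closure.mem_of_tendsto (h.tend1 c) (Eventually.of_forall fun i => ?_)
    refine map_mem_closure (f := fun k => c * k) (by fun_prop) (dA (h.kappa_mem i)) ?_
    rintro _ ⟨a, rfl⟩
    exact ⟨c * ιs a, by rw [mul_assoc]⟩
  let R : Submodule ℂ (Y × Cs) :=
    { carrier := {p | ∃ c, p = (F.lsmul c x, c * r)}
      zero_mem' := ⟨0, by
        have := F.smul_lsmul 0 0 x
        simp only [zero_smul] at this
        rw [this, zero_mul]; rfl⟩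
      add_mem' := by
        rintro _ _ ⟨c, rfl⟩ ⟨d, rfl⟩
        exact ⟨c + d, by rw [F.add_lsmul, add_mul]; rfl⟩
      smul_mem' := by
        rintro t _ ⟨c, rfl⟩
        exact ⟨t • c, by rw [F.smul_lsmul, smul_mul_assoc]; rfl⟩ }
  have key : ∀ c d, (c * r) * star (d * r) = F.linn (F.lsmul c x) (F.lsmul d x) := by
    intro c d
    rw [F.linn_lsmul_left, F.linn_lsmul_right, ← hrp, star_mul, hrs]
    simp only [mul_assoc]
  obtain ⟨Φ, hΦ⟩ := exists_isom R
    (by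
      rintro _ ⟨c, rfl⟩
      have h1 := congrArg norm (key c c)
      rw [CStarRing.norm_self_mul_star, F.norm_linn, ← sq] at h1
      exact ((sq_eq_sq₀ (norm_nonneg _) (norm_nonneg _)).1 h1).symm)
    (by
      refine dY.mono ?_
      rintro _ ⟨c, rfl⟩
      exact ⟨_, ⟨c, rfl⟩, rfl⟩)
    (by
      refine dC.mono ?_
      rintro _ ⟨c, rfl⟩
      exact ⟨_, ⟨c, rfl⟩, rfl⟩)
  have hΦ' : ∀ c, Φ (F.lsmul c x) = c * r := fun c => hΦ _ ⟨c, rfl⟩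
  have hlinn1 : ∀ c z, Φ (F.lsmul c x) * star (Φ z) = F.linn (F.lsmul c x) z := by
    intro c z
    have : IsClosed {z | Φ (F.lsmul c x) * star (Φ z) = F.linn (F.lsmul c x) z} :=
      isClosed_eq (by fun_prop) (F.cont_linn_right _)
    refine this.closure_subset_iff.2 ?_ (dY z)
    rintro _ ⟨d, rfl⟩
    show _ = _
    rw [hΦ', hΦ', key]
  have hlinn : ∀ y z, Φ y * star (Φ z) = F.linn y z := by
    intro y z
    have : IsClosed {y | Φ y * star (Φ z) = F.linn y z} :=
      isClosed_eq (by fun_prop) (F.cont_linn_left _)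
    refine this.closure_subset_iff.2 ?_ (dY y)
    rintro _ ⟨d, rfl⟩
    exact hlinn1 d z
  refine ⟨Φ, hlinn, ?_, ?_⟩
  · intro c y
    have : IsClosed {y | Φ (F.lsmul c y) = c * Φ y} :=
      isClosed_eq (Φ.continuous.comp (F.cont_lsmul_right _)) (by fun_prop)
    refine this.closure_subset_iff.2 ?_ (dY y)
    rintro _ ⟨d, rfl⟩
    show _ = _
    rw [← F.mul_lsmul, hΦ', hΦ', mul_assoc]
  · have hXc : IsClosed (Φ '' (X : Set Y)) := Φ.toHomeomorph.isClosedMap _ hF.closed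
    obtain ⟨b, hb⟩ := hrB'
    refine Set.Subset.antisymm ?_ ?_
    · rintro _ ⟨y, hy, rfl⟩
      have := map_mem_closure Φ.continuous (dX hy) (t := Set.range ⇑ιs) ?_
      · rwa [hcl.closure_eq] at this
      · rintro _ ⟨a, rfl⟩
        exact ⟨a * b, by rw [hΦ', map_mul, hb]⟩
    · refine dA.trans (closure_minimal ?_ hXc)
      rintro _ ⟨a, rfl⟩
      exact ⟨F.lsmul (ιs a) x, hF.lsmul_mem _ _ hx, hΦ' _⟩

end core

section staralg
variable {C : Type*} [NonUnitalCStarAlgebra C]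

lemma bij_of_inj_dense {B : Type*} [NonUnitalCStarAlgebra B] (φ : B →⋆ₙₐ[ℂ] C)
    (hi : Function.Injective φ) (hd : Dense (Set.range φ)) : Function.Bijective φ := by
  refine ⟨hi, ?_⟩
  have hc : IsClosed (Set.range φ) :=
    (NonUnitalStarAlgHom.isometry φ hi).isClosedEmbedding.isClosed_range
  rw [← Set.range_eq_univ, ← hc.closure_eq]
  exact hd.closure_eq

lemma exists_starEquiv (S : NonUnitalStarSubalgebra ℂ (C × C)) (hS : IsClosed (S : Set (C × C)))
    (h1 : ∀ p ∈ S, p.1 = 0 → p.2 = 0) (h2 : ∀ p ∈ S, p.2 = 0 → p.1 = 0)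
    (hd1 : Dense (Prod.fst '' (S : Set (C × C)))) (hd2 : Dense (Prod.snd '' (S : Set (C × C)))) :
    ∃ α : C ≃⋆ₐ[ℂ] C, ∀ d c, (d, c) ∈ S ↔ α d = c := by
  have : IsClosed (S : Set (C × C)) := hS
  let p1 : S →⋆ₙₐ[ℂ] C := (NonUnitalStarAlgHom.fst ℂ C C).comp (NonUnitalStarSubalgebraClass.subtype S)
  let p2 : S →⋆ₙₐ[ℂ] C := (NonUnitalStarAlgHom.snd ℂ C C).comp (NonUnitalStarSubalgebraClass.subtype S)
  have b1 : Function.Bijective p1 := by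
    refine bij_of_inj_dense p1 ?_ ?_
    · rw [injective_iff_map_eq_zero]
      intro a ha
      exact Subtype.ext (Prod.ext ha (h1 a a.2 ha))
    · refine hd1.mono ?_
      rintro _ ⟨p, hp, rfl⟩
      exact ⟨⟨p, hp⟩, rfl⟩
  have b2 : Function.Bijective p2 := by
    refine bij_of_inj_dense p2 ?_ ?_
    · rw [injective_iff_map_eq_zero]
      intro a ha
      exact Subtype.ext (Prod.ext (h2 a a.2 ha) ha)
    · refine hd2.mono ?_
      rintro _ ⟨p, hp, rfl⟩
      exact ⟨⟨p, hp⟩, rfl⟩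
  let e1 := StarAlgEquiv.ofBijective p1 b1
  let e2 := StarAlgEquiv.ofBijective p2 b2
  refine ⟨e1.symm.trans e2, fun d c => ⟨fun h => ?_, fun h => ?_⟩⟩
  · have : e1.symm d = ⟨(d, c), h⟩ := by
      rw [← StarAlgEquiv.symm_apply_apply e1 ⟨(d, c), h⟩]; rfl
    show e2 (e1.symm d) = c
    rw [this]; rfl
  · have h3 : e2 (e1.symm d) = c := h
    have h4 : e1 (e1.symm d) = d := StarAlgEquiv.apply_symm_apply e1 d
    have : ((e1.symm d : S) : C × C) = (d, c) := Prod.ext h4 h3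
    rw [← this]; exact (e1.symm d).2
end staralg

lemma eq_of_mul_left {C : Type*} [NonUnitalCStarAlgebra C] {a b : C} (h : ∀ c, c * a = c * b) :
    a = b := by
  rw [← sub_eq_zero, ← CStarRing.star_mul_self_eq_zero_iff, mul_sub, h, sub_self]

lemma eq_of_mul_right {C : Type*} [NonUnitalCStarAlgebra C] {a b : C} (h : ∀ c, a * c = b * c) :
    a = b := by
  rw [← sub_eq_zero, ← CStarRing.mul_star_self_eq_zero_iff, sub_mul, h, sub_self]

section alpha
variable {As Cs I Y : Type*}
    [NonUnitalCStarAlgebra As]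
    [NonUnitalCStarAlgebra Cs] [PartialOrder Cs] [StarOrderedRing Cs]
    [NormedAddCommGroup Y] [NormedSpace ℂ Y] [CompleteSpace Y]
    {l : Filter I} {s : I → Cs}

/-- the bimodule induced by an automorphism -/
def alphaBimod [l.NeBot] {S : Set Cs} (h : ShiftData S l s) (α : Cs ≃⋆ₐ[ℂ] Cs) :
    EquivBimodule Cs Cs Cs where
  lsmul := fun c x => c * x
  rsmul := fun x c => x * α c
  linn := fun x y => x * star y
  rinn := fun x y => α.symm (star x * y)
  lsmul_add := mul_add
  add_lsmul := add_mul
  mul_lsmul := mul_assoc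
  smul_lsmul := fun z c x => smul_mul_assoc z c x
  lsmul_smul := fun z c x => mul_smul_comm z c x
  add_rsmul := fun x y d => add_mul _ _ _
  rsmul_add := fun x d d' => by rw [map_add, mul_add]
  rsmul_mul := fun x d d' => by rw [map_mul, mul_assoc]
  rsmul_smul := fun z x d => smul_mul_assoc _ _ _
  smul_rsmul := fun z x d => by rw [map_smul, mul_smul_comm]
  lsmul_rsmul := fun c x d => mul_assoc _ _ _
  linn_add_left := fun x y z => add_mul _ _ _
  linn_smul_left := fun z x y => smul_mul_assoc _ _ _
  linn_star := fun x y => by simp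
  linn_lsmul_left := fun c x y => mul_assoc _ _ _
  linn_nonneg := fun x => mul_star_self_nonneg x
  linn_definite := fun x hx => CStarRing.mul_star_self_eq_zero_iff x |>.1 hx
  rinn_add_right := fun x y z => by rw [mul_add, map_add]
  rinn_smul_right := fun z x y => by rw [mul_smul_comm, map_smul]
  rinn_star := fun x y => by rw [← map_star]; simp
  rinn_rsmul_right := fun x y d => by rw [← mul_assoc, map_mul]; simp
  rinn_nonneg := fun x => by rw [map_mul, map_star]; exact star_mul_self_nonneg _
  rinn_definite := fun x hx => by
    have : star x * x = 0 := (map_eq_zero_iff α.symm α.symm.injective).1 hx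
    exact CStarRing.star_mul_self_eq_zero_iff x |>.1 this
  imprimitivity := fun x y z => by simp [mul_assoc]
  norm_linn := fun x => by rw [CStarRing.norm_self_mul_star, sq]
  norm_rinn := fun x => by
    rw [NonUnitalStarAlgHom.norm_map α.symm α.symm.injective, CStarRing.norm_star_mul_self, sq]
  full_left := fun c => by
    refine isClosed_closure.mem_of_tendsto (h.tend1 c) (Eventually.of_forall fun i => ?_)
    exact subset_closure (Submodule.subset_span ⟨c, s i * star (s i), by simp⟩)
  full_right := fun c => by
    have h2 : Continuous α.symm := (NonUnitalStarAlgHom.isometry α.symm α.symm.injective).continuous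
    have := (h2.tendsto _).comp (h.tend2 (α c))
    simp only [StarAlgEquiv.symm_apply_apply] at this
    refine isClosed_closure.mem_of_tendsto this (Eventually.of_forall fun i => ?_)
    refine subset_closure (Submodule.subset_span ⟨s i * star (s i), α c, by simp⟩)

theorem exists_alpha [l.NeBot] (ιs : As →⋆ₙₐ[ℂ] Cs) (hcl : IsClosed (Set.range ⇑ιs))
    (h : ShiftData (Set.range ⇑ιs) l s)
    (F : EquivBimodule Cs Cs Y) (X : Submodule ℂ Y)
    (hF : IsEquiPair ⇑ιs F X) (Φ : Y ≃ₗᵢ[ℂ] Cs) (hΦl : ∀ y z, Φ y * star (Φ z) = F.linn y z)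
    (hΦs : ∀ c y, Φ (F.lsmul c y) = c * Φ y) (hΦX : Φ '' (X : Set Y) = Set.range ⇑ιs) :
    ∃ (α : Cs ≃⋆ₐ[ℂ] Cs), ⇑α '' Set.range ⇑ιs = Set.range ⇑ιs ∧
          ∃ (Eα : EquivBimodule Cs Cs Cs), IsAlphaData ⇑α ⇑α.symm Eα ∧
            Nonempty (F.Iso Eα) := by
  have r0 : ∀ y, F.rsmul y 0 = 0 := fun y => by simpa using F.smul_rsmul 0 y 0
  let S : NonUnitalStarSubalgebra ℂ (Cs × Cs) :=
    { carrier := {p | ∀ y, Φ (F.rsmul y p.1) = Φ y * p.2}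
      zero_mem' := fun y => by simp [r0]
      add_mem' := fun {p q} hp hq y => by
        have h1 := hp y
        have h2 := hq y
        simp only [Prod.fst_add, Prod.snd_add, F.rsmul_add, map_add, mul_add, h1, h2]
      mul_mem' := fun {p q} hp hq y => by
        have h1 := hp y
        have h2 := hq (F.rsmul y p.1)
        simp only [Prod.fst_mul, Prod.snd_mul, F.rsmul_mul]
        rw [h2, h1, mul_assoc]
      smul_mem' := fun z p hp y => by
        have h1 := hp y
        simp only [Prod.smul_fst, Prod.smul_snd, F.smul_rsmul, map_smul, mul_smul_comm, h1]
      star_mem' := fun {p} hp y => by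
        simp only [Prod.fst_star, Prod.snd_star]
        refine eq_of_mul_right fun w => ?_
        obtain ⟨z, hz⟩ := Φ.surjective (star w)
        have h1 := hp z
        have h2 := hΦl (F.rsmul y (star p.1)) z
        rw [F.linn_rsmul, ← hΦl, h1, hz] at h2
        simpa [mul_assoc] using h2 }
  have hmem : ∀ y z, (F.rinn y z, star (Φ y) * Φ z) ∈ S := by
    intro y z w
    show Φ (F.rsmul w (F.rinn y z)) = _
    rw [← F.imprimitivity, hΦs, ← hΦl, mul_assoc]
  have hSc : IsClosed (S : Set (Cs × Cs)) := by
    have : (S : Set (Cs × Cs)) = ⋂ y, {p | Φ (F.rsmul y p.1) = Φ y * p.2} := by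
      ext p; simp only [Set.mem_iInter]; rfl
    rw [this]
    refine isClosed_iInter fun y => isClosed_eq ?_ (by fun_prop)
    exact Φ.continuous.comp ((F.cont_rsmul_right y).comp continuous_fst)
  have hex : ∃ α : Cs ≃⋆ₐ[ℂ] Cs, ∀ d c, (d, c) ∈ S ↔ α d = c := by
    refine exists_starEquiv S hSc ?_ ?_ ?_ ?_
    · intro p hp h0
      have h1 : ∀ y, Φ (F.rsmul y p.1) = Φ y * p.2 := hp
      refine eq_of_mul_left fun c => ?_
      obtain ⟨y, rfl⟩ := Φ.surjective c
      rw [← h1, h0, r0]; simp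
    · intro p hp h0
      have h1 : ∀ y, Φ (F.rsmul y p.1) = Φ y * p.2 := hp
      refine F.rsmul_faithful fun y => ?_
      apply Φ.injective
      rw [h1, h0, r0]; simp
    · refine F.full_right.mono ?_
      let L : Submodule ℂ Cs := S.toSubmodule.map (LinearMap.fst ℂ Cs Cs)
      have : Submodule.span ℂ {d | ∃ x y, d = F.rinn x y} ≤ L := by
        rw [Submodule.span_le]
        rintro _ ⟨x, y, rfl⟩
        exact ⟨_, hmem x y, rfl⟩
      intro c hc
      obtain ⟨p, hp, hpc⟩ := this hc
      exact ⟨p, hp, hpc⟩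
    · intro c
      refine isClosed_closure.mem_of_tendsto (h.tend2 c) (Eventually.of_forall fun i => ?_)
      refine subset_closure ⟨_, hmem (Φ.symm (s i * star (s i))) (Φ.symm c), ?_⟩
      simp
  obtain ⟨α, hα⟩ := hex
  have hα1 : ∀ y d, Φ (F.rsmul y d) = Φ y * α d := by
    intro y d
    exact (hα d (α d)).2 rfl y
  have hα2 : ∀ y z, α (F.rinn y z) = star (Φ y) * Φ z := fun y z => (hα _ _).1 (hmem y z)
  have hαc : Continuous α := (NonUnitalStarAlgHom.isometry α α.injective).continuous
  have hαc' : Continuous α.symm :=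
    (NonUnitalStarAlgHom.isometry α.symm α.symm.injective).continuous
  have hr : ∀ z ∈ X, ∃ a, ιs a = Φ z := by
    intro z hz
    have : Φ z ∈ Set.range ⇑ιs := by rw [← hΦX]; exact ⟨z, hz, rfl⟩
    exact this
  have hr' : ∀ a ∈ Set.range ⇑ιs, ∃ z ∈ X, Φ z = a := by
    intro a ha
    rw [← hΦX] at ha
    exact ha
  refine ⟨α, ?_, alphaBimod h α, ⟨rfl, rfl, rfl, rfl⟩, ⟨?_⟩⟩
  · refine Set.Subset.antisymm ?_ ?_
    · rintro _ ⟨c, hc, rfl⟩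
      rw [← hF.span_XX_right] at hc
      let L : Submodule ℂ Cs := LinearMap.range (ιs : As →ₗ[ℂ] Cs)
      have := map_mem_closure hαc hc (t := Set.range ⇑ιs) ?_
      · rwa [hcl.closure_eq] at this
      · intro c hc
        have h1 : Submodule.span ℂ {d | ∃ x ∈ X, ∃ y ∈ X, d = F.rinn x y} ≤
            L.comap (α : Cs →ₗ[ℂ] Cs) := by
          rw [Submodule.span_le]
          rintro _ ⟨x, hx, y, hy, rfl⟩
          obtain ⟨a, ha⟩ := hr x hx
          obtain ⟨b, hb⟩ := hr y hy
          refine ⟨star a * b, ?_⟩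
          show ιs (star a * b) = α (F.rinn x y)
          rw [hα2, map_mul, map_star, ha, hb]
        exact h1 hc
    · rintro _ ⟨a, rfl⟩
      refine ⟨α.symm (ιs a), ?_, by simp⟩
      have h1 := (hαc'.tendsto _).comp (h.tend2 (ιs a))
      refine hcl.mem_of_tendsto h1 (Eventually.of_forall fun i => ?_)
      obtain ⟨y, hy, hya⟩ := hr' _ (h.kappa_mem i)
      obtain ⟨z, hz, hza⟩ := hr' _ ⟨a, rfl⟩
      have h2 := hα2 y z
      rw [hya, hza, h.kappa_star] at h2
      simp only [Function.comp]
      rw [← h2, StarAlgEquiv.symm_apply_apply]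
      exact hF.rinn_mem y hy z hz
  · exact
      { toEquiv := Φ.toLinearEquiv
        map_lsmul := hΦs
        map_rsmul := hα1
        map_linn := hΦl
        map_rinn := fun x y => by
          show α.symm (star (Φ x) * Φ y) = _
          rw [← hα2, StarAlgEquiv.symm_apply_apply] }

end alpha

section mult
variable {C : Type*} [NonUnitalCStarAlgebra C]

lemma m_snd_mul (u : 𝓜(ℂ, C)) (a b : C) : u.snd (a * b) = a * u.snd b := by
  refine eq_of_mul_right fun c => ?_
  rw [u.central, mul_assoc, mul_assoc, u.central]

lemma m_fst_mul (u : 𝓜(ℂ, C)) (a b : C) : u.fst (a * b) = u.fst a * b := by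
  refine eq_of_mul_left fun c => ?_
  rw [← u.central, ← mul_assoc, ← mul_assoc, u.central]

lemma m_fst_snd (u v : 𝓜(ℂ, C)) (c : C) : u.fst (v.snd c) = v.snd (u.fst c) := by
  refine eq_of_mul_left fun x => ?_
  rw [← u.central, ← m_snd_mul, u.central, m_snd_mul]

lemma m_star_snd (u : 𝓜(ℂ, C)) (c : C) : star (u.snd c) = (star u).fst (star c) := by
  rw [DoubleCentralizer.star_fst, star_star]

lemma m_star_fst (u : 𝓜(ℂ, C)) (c : C) : star (u.fst c) = (star u).snd (star c) := by
  rw [DoubleCentralizer.star_snd, star_star]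

lemma m_mul_fst (u v : 𝓜(ℂ, C)) (c : C) : (u * v).fst c = u.fst (v.fst c) := by
  rw [DoubleCentralizer.mul_fst]; rfl

lemma m_mul_snd (u v : 𝓜(ℂ, C)) (c : C) : (u * v).snd c = v.snd (u.snd c) := by
  rw [DoubleCentralizer.mul_snd]; rfl

lemma m_one_fst (c : C) : (1 : 𝓜(ℂ, C)).fst c = c := by
  rw [DoubleCentralizer.one_fst]; rfl

lemma m_one_snd (c : C) : (1 : 𝓜(ℂ, C)).snd c = c := by
  rw [DoubleCentralizer.one_snd]; rfl

lemma m_ext {u v : 𝓜(ℂ, C)} (h1 : ∀ c, u.fst c = v.fst c) (h2 : ∀ c, u.snd c = v.snd c) :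
    u = v :=
  DoubleCentralizer.ext ℂ C u v
    (Prod.ext (ContinuousLinearMap.ext h1) (ContinuousLinearMap.ext h2))

variable {u : 𝓜(ℂ, C)} (hu : u ∈ unitary 𝓜(ℂ, C))

lemma u_fsf (hu : u ∈ unitary 𝓜(ℂ, C)) (c : C) : (star u).fst (u.fst c) = c := by
  rw [← m_mul_fst, (Unitary.mem_iff.1 hu).1, m_one_fst]

lemma u_ffs (hu : u ∈ unitary 𝓜(ℂ, C)) (c : C) : u.fst ((star u).fst c) = c := by
  rw [← m_mul_fst, (Unitary.mem_iff.1 hu).2, m_one_fst]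

lemma u_sss (hu : u ∈ unitary 𝓜(ℂ, C)) (c : C) : u.snd ((star u).snd c) = c := by
  rw [← m_mul_snd, (Unitary.mem_iff.1 hu).1, m_one_snd]

lemma u_ssu (hu : u ∈ unitary 𝓜(ℂ, C)) (c : C) : (star u).snd (u.snd c) = c := by
  rw [← m_mul_snd, (Unitary.mem_iff.1 hu).2, m_one_snd]

/-- `u b = (u b u*) u` -/
lemma u_fst_eq (hu : u ∈ unitary 𝓜(ℂ, C)) (b : C) : u.fst b = u.snd (mAd u b) := by
  rw [mAd, ← m_fst_snd, u_sss hu]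

/-- `(a u) b = (a (u b u*)) u` -/
lemma u_snd_mul (hu : u ∈ unitary 𝓜(ℂ, C)) (a b : C) : u.snd a * b = u.snd (a * mAd u b) := by
  rw [u.central, u_fst_eq hu, m_snd_mul]

/-- `(a u) (b u)* = a b*` -/
lemma u_linn (hu : u ∈ unitary 𝓜(ℂ, C)) (a b : C) : u.snd a * star (u.snd b) = a * star b := by
  rw [m_star_snd, u.central, u_ffs hu]

/-- `(a u)* (b u) = u* a* b u` -/
lemma u_rinn (a b : C) : star (u.snd a) * u.snd b = mAd (star u) (star a * b) := by
  rw [m_star_snd, mAd, star_star, ← m_snd_mul, ← m_fst_mul, m_fst_snd]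

lemma mAd_mAd (hu : u ∈ unitary 𝓜(ℂ, C)) (c : C) : mAd (star u) (mAd u c) = c := by
  rw [mAd, mAd, star_star, ← m_fst_snd, u_sss hu, u_fsf hu]

lemma mAd_mAd' (hu : u ∈ unitary 𝓜(ℂ, C)) (c : C) : mAd u (mAd (star u) c) = c := by
  rw [mAd, mAd, star_star, ← m_fst_snd, u_ssu hu, u_ffs hu]

lemma cont_mAd (u : 𝓜(ℂ, C)) : Continuous (mAd u) :=
  u.fst.continuous.comp (star u).snd.continuous

variable {A : Type*} [NonUnitalCStarAlgebra A]

lemma mem_AuSub (ι : A →⋆ₙₐ[ℂ] C) (u : 𝓜(ℂ, C)) (x : C) :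
    x ∈ AuSub ⇑ι u ↔ ∃ a, x = u.snd (ι a) := by
  constructor
  · intro h
    induction h using Submodule.span_induction with
    | mem x hx => exact hx
    | zero => exact ⟨0, by simp⟩
    | add x y _ _ hx hy =>
      obtain ⟨a, rfl⟩ := hx
      obtain ⟨b, rfl⟩ := hy
      exact ⟨a + b, by simp⟩
    | smul z x _ hx =>
      obtain ⟨a, rfl⟩ := hx
      exact ⟨z • a, by simp⟩
  · intro h
    exact Submodule.subset_span h

lemma mem_AuSub' (ι : A →⋆ₙₐ[ℂ] C) (hu : u ∈ unitary 𝓜(ℂ, C)) (x : C) :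
    x ∈ AuSub ⇑ι u ↔ (star u).snd x ∈ Set.range ⇑ι := by
  rw [mem_AuSub]
  constructor
  · rintro ⟨a, rfl⟩
    exact ⟨a, (u_ssu hu _).symm⟩
  · rintro ⟨a, ha⟩
    exact ⟨a, by rw [ha, u_sss hu]⟩

lemma closed_AuSub (ι : A →⋆ₙₐ[ℂ] C) (hcl : IsClosed (Set.range ⇑ι))
    (hu : u ∈ unitary 𝓜(ℂ, C)) : IsClosed (AuSub ⇑ι u : Set C) := by
  have : (AuSub ⇑ι u : Set C) = (star u).snd ⁻¹' (Set.range ⇑ι) := by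
    ext x; exact mem_AuSub' ι hu x
  rw [this]
  exact hcl.preimage (star u).snd.continuous
end mult

section one
variable {As Cs I : Type*}
    [NonUnitalCStarAlgebra As]
    [NonUnitalCStarAlgebra Cs] [PartialOrder Cs] [StarOrderedRing Cs]
    {l : Filter I} {s : I → Cs}

lemma mul_mem_range (ιs : As →⋆ₙₐ[ℂ] Cs) {a b : Cs} (ha : a ∈ Set.range ⇑ιs)
    (hb : b ∈ Set.range ⇑ιs) : a * b ∈ Set.range ⇑ιs := by
  obtain ⟨a, rfl⟩ := ha
  obtain ⟨b, rfl⟩ := hb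
  exact ⟨a * b, by simp⟩

lemma star_mem_range (ιs : As →⋆ₙₐ[ℂ] Cs) {a : Cs} (ha : a ∈ Set.range ⇑ιs) :
    star a ∈ Set.range ⇑ιs := by
  obtain ⟨a, rfl⟩ := ha
  exact ⟨star a, map_star _ _⟩

lemma span_le_range (ιs : As →⋆ₙₐ[ℂ] Cs) {G : Set Cs} (hG : G ⊆ Set.range ⇑ιs)
    (hcl : IsClosed (Set.range ⇑ιs)) :
    closure (Submodule.span ℂ G : Set Cs) ⊆ Set.range ⇑ιs := by
  refine closure_minimal ?_ hcl
  have : Submodule.span ℂ G ≤ LinearMap.range (ιs : As →ₗ[ℂ] Cs) := by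
    rw [Submodule.span_le]
    exact hG
  exact this

theorem part_one [l.NeBot] (ιs : As →⋆ₙₐ[ℂ] Cs) (hcl : IsClosed (Set.range ⇑ιs))
    (h : ShiftData (Set.range ⇑ιs) l s) (u : 𝓜(ℂ, Cs)) (hK : mem_KMC ⇑ιs u)
    (T : EquivBimodule Cs Cs Cs) (hT : IsTrivialData T) : IsEquiPair ⇑ιs T (AuSub ⇑ιs u) := by
  obtain ⟨h1, h2, h3, h4⟩ := hT
  obtain ⟨hu, hu1, hu2⟩ := hK
  have hk : ∀ i, ∃ a, ιs a = s i * star (s i) := fun i => h.kappa_mem i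
  have hku : ∀ i, u.snd (s i * star (s i)) ∈ AuSub ⇑ιs u := fun i => by
    obtain ⟨a, ha⟩ := hk i
    rw [mem_AuSub]; exact ⟨a, by rw [ha]⟩
  have hlm : ∀ x ∈ AuSub ⇑ιs u, ∀ y ∈ AuSub ⇑ιs u, x * star y ∈ Set.range ⇑ιs := by
    intro x hx y hy
    obtain ⟨a, rfl⟩ := (mem_AuSub ιs u x).1 hx
    obtain ⟨b, rfl⟩ := (mem_AuSub ιs u y).1 hy
    rw [u_linn hu]
    exact ⟨a * star b, by rw [map_mul, map_star]⟩
  have hrm : ∀ x ∈ AuSub ⇑ιs u, ∀ y ∈ AuSub ⇑ιs u, star x * y ∈ Set.range ⇑ιs := by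
    intro x hx y hy
    obtain ⟨a, rfl⟩ := (mem_AuSub ιs u x).1 hx
    obtain ⟨b, rfl⟩ := (mem_AuSub ιs u y).1 hy
    rw [u_rinn]
    have := hu2 (star a * b)
    rwa [map_mul, map_star] at this
  constructor
  · exact closed_AuSub ιs hcl hu
  · intro a x hx
    obtain ⟨b, rfl⟩ := (mem_AuSub ιs u x).1 hx
    rw [h1, mem_AuSub]
    exact ⟨a * b, by simp [m_snd_mul]⟩
  · intro b x hx
    obtain ⟨a, rfl⟩ := (mem_AuSub ιs u x).1 hx
    rw [h2, mem_AuSub]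
    obtain ⟨b', hb'⟩ := hu1 b
    exact ⟨a * b', by simp only [map_mul, hb']; exact u_snd_mul hu _ _⟩
  · rw [h3]; exact hlm
  · rw [h4]; exact hrm
  · refine Set.Subset.antisymm (span_le_range ιs ?_ hcl) ?_
    · rintro _ ⟨x, hx, y, hy, rfl⟩
      rw [h3]; exact hlm x hx y hy
    · rintro _ ⟨a, rfl⟩
      refine isClosed_closure.mem_of_tendsto (h.tend1 (ιs a)) (Eventually.of_forall fun i => ?_)
      refine subset_closure (Submodule.subset_span
        ⟨u.snd (ιs a), (mem_AuSub ιs u _).2 ⟨a, rfl⟩, _, hku i, ?_⟩)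
      simp only [h3]
      rw [u_linn hu, h.kappa_star]
  · intro c
    refine isClosed_closure.mem_of_tendsto (h.tend1 c) (Eventually.of_forall fun i => ?_)
    refine subset_closure (Submodule.subset_span ⟨u.snd c, _, hku i, ?_⟩)
    simp only [h3]
    rw [u_linn hu, h.kappa_star]
  · refine Set.Subset.antisymm (span_le_range ιs ?_ hcl) ?_
    · rintro _ ⟨x, hx, y, hy, rfl⟩
      rw [h4]; exact hrm x hx y hy
    · rintro _ ⟨a, rfl⟩
      obtain ⟨b, hb⟩ := hu1 a
      have h5 := ((cont_mAd (star u)).tendsto _).comp (h.tend2 (ιs b))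
      rw [hb, mAd_mAd hu] at h5
      refine isClosed_closure.mem_of_tendsto h5 (Eventually.of_forall fun i => ?_)
      refine subset_closure (Submodule.subset_span
        ⟨_, hku i, u.snd (ιs b), (mem_AuSub ιs u _).2 ⟨b, rfl⟩, ?_⟩)
      simp only [h4, Function.comp]
      rw [u_rinn, h.kappa_star, hb]
  · intro c
    have h5 := ((cont_mAd (star u)).tendsto _).comp (h.tend1 (mAd u c))
    rw [mAd_mAd hu] at h5
    refine isClosed_closure.mem_of_tendsto h5 (Eventually.of_forall fun i => ?_)
    refine subset_closure (Submodule.subset_span ⟨u.snd (star (mAd u c)), _, hku i, ?_⟩)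
    simp only [h4, Function.comp]
    rw [u_rinn, star_star]

theorem part_six [l.NeBot] (ιs : As →⋆ₙₐ[ℂ] Cs) (hcl : IsClosed (Set.range ⇑ιs))
    (h : ShiftData (Set.range ⇑ιs) l s) (α : Cs ≃⋆ₐ[ℂ] Cs)
    (hα : ⇑α '' Set.range ⇑ιs = Set.range ⇑ιs) (E : EquivBimodule Cs Cs Cs)
    (hE : IsAlphaData ⇑α ⇑α.symm E) : ∃ X : Submodule ℂ Cs, IsEquiPair ⇑ιs E X := by
  obtain ⟨h1, h2, h3, h4⟩ := hE
  let X : Submodule ℂ Cs := LinearMap.range (ιs : As →ₗ[ℂ] Cs)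
  have hX : ∀ x, x ∈ X ↔ x ∈ Set.range ⇑ιs := fun x => Iff.rfl
  have hk := h.kappa_mem
  have ha1 : ∀ a ∈ Set.range ⇑ιs, α a ∈ Set.range ⇑ιs := fun a ha => by
    rw [← hα]; exact ⟨a, ha, rfl⟩
  have ha2 : ∀ a ∈ Set.range ⇑ιs, α.symm a ∈ Set.range ⇑ιs := fun a ha => by
    rw [← hα] at ha
    obtain ⟨b, hb, rfl⟩ := ha
    simpa using hb
  have hαc' : Continuous α.symm :=
    (NonUnitalStarAlgHom.isometry α.symm α.symm.injective).continuous
  refine ⟨X, ?_⟩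
  constructor
  · exact hcl
  · intro a x hx
    rw [h1, hX]
    exact mul_mem_range ιs ⟨a, rfl⟩ hx
  · intro b x hx
    rw [h2, hX]
    exact mul_mem_range ιs hx (ha1 _ ⟨b, rfl⟩)
  · rw [h3]
    exact fun x hx y hy => mul_mem_range ιs hx (star_mem_range ιs hy)
  · rw [h4]
    exact fun x hx y hy => ha2 _ (mul_mem_range ιs (star_mem_range ιs hx) hy)
  · refine Set.Subset.antisymm (span_le_range ιs ?_ hcl) ?_
    · rintro _ ⟨x, hx, y, hy, rfl⟩
      rw [h3]
      exact mul_mem_range ιs hx (star_mem_range ιs hy)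
    · intro a ha
      refine isClosed_closure.mem_of_tendsto (h.tend1 a) (Eventually.of_forall fun i => ?_)
      refine subset_closure (Submodule.subset_span ⟨a, ha, _, hk i, ?_⟩)
      simp only [h3]
      rw [h.kappa_star]
  · intro c
    refine isClosed_closure.mem_of_tendsto (h.tend1 c) (Eventually.of_forall fun i => ?_)
    refine subset_closure (Submodule.subset_span ⟨c, _, hk i, ?_⟩)
    simp only [h3]
    rw [h.kappa_star]
  · refine Set.Subset.antisymm (span_le_range ιs ?_ hcl) ?_
    · rintro _ ⟨x, hx, y, hy, rfl⟩
      rw [h4]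
      exact ha2 _ (mul_mem_range ιs (star_mem_range ιs hx) hy)
    · intro a ha
      have h5 := (hαc'.tendsto _).comp (h.tend2 (α a))
      rw [StarAlgEquiv.symm_apply_apply] at h5
      refine isClosed_closure.mem_of_tendsto h5 (Eventually.of_forall fun i => ?_)
      refine subset_closure (Submodule.subset_span ⟨_, hk i, α a, ha1 _ ha, ?_⟩)
      simp only [h4, Function.comp]
      rw [h.kappa_star]
  · intro c
    have h5 := (hαc'.tendsto _).comp (h.tend1 (α c))
    rw [StarAlgEquiv.symm_apply_apply] at h5
    refine isClosed_closure.mem_of_tendsto h5 (Eventually.of_forall fun i => ?_)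
    refine subset_closure (Submodule.subset_span ⟨star (α c), _, hk i, ?_⟩)
    simp only [h4, Function.comp, star_star]
end one

section two
variable {As Cs I : Type*}
    [NonUnitalCStarAlgebra As]
    [NonUnitalCStarAlgebra Cs] [PartialOrder Cs] [StarOrderedRing Cs]
    {l : Filter I} {s : I → Cs}

lemma isMult_iff (ιs : As →⋆ₙₐ[ℂ] Cs) (u v : 𝓜(ℂ, Cs)) (hu : u ∈ unitary 𝓜(ℂ, Cs))
    (hv : v ∈ unitary 𝓜(ℂ, Cs)) :
    IsMultiplierOf ⇑ιs (u * star v) ↔ AuSub ⇑ιs u = AuSub ⇑ιs v := by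
  have h1 : ∀ a, (u * star v).snd (ιs a) ∈ Set.range ⇑ιs ↔ u.snd (ιs a) ∈ AuSub ⇑ιs v := by
    intro a
    rw [mem_AuSub' ιs hv, m_mul_snd]
  have h2 : ∀ a, (u * star v).fst (ιs a) ∈ Set.range ⇑ιs ↔
      v.snd (ιs (star a)) ∈ AuSub ⇑ιs u := by
    intro a
    have : (star u).snd (v.snd (ιs (star a))) = star ((u * star v).fst (ιs a)) := by
      rw [m_mul_fst, m_star_fst, m_star_fst, star_star, map_star]
    rw [mem_AuSub' ιs hu, this]
    refine ⟨star_mem_range ιs, fun h => ?_⟩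
    simpa using star_mem_range ιs h
  constructor
  · rintro ⟨g1, g2⟩
    refine le_antisymm ?_ ?_
    · intro x hx
      obtain ⟨a, rfl⟩ := (mem_AuSub ιs u x).1 hx
      exact (h1 a).1 (g2 a)
    · intro x hx
      obtain ⟨a, rfl⟩ := (mem_AuSub ιs v x).1 hx
      have := (h2 (star a)).1 (g1 _)
      rwa [star_star] at this
  · intro he
    refine ⟨fun a => (h2 a).2 ?_, fun a => (h1 a).2 ?_⟩
    · rw [he]; exact (mem_AuSub ιs v _).2 ⟨_, rfl⟩
    · rw [← he]; exact (mem_AuSub ιs u _).2 ⟨_, rfl⟩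

lemma iso_scalar (hcomm : ∀ m : 𝓜(ℂ, Cs), (∀ c : Cs, m * (c : 𝓜(ℂ, Cs)) = (c : 𝓜(ℂ, Cs)) * m) →
      ∃ z : ℂ, m = z • (1 : 𝓜(ℂ, Cs))) (T : EquivBimodule Cs Cs Cs) (hT : IsTrivialData T)
    (Φ : T.Iso T) : ∃ z : ℂ, ∀ y, Φ.toEquiv y = z • y := by
  obtain ⟨h1, h2, h3, h4⟩ := hT
  have hl : ∀ c y, Φ.toEquiv (c * y) = c * Φ.toEquiv y := by
    have := Φ.map_lsmul
    rwa [h1] at this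
  have hr : ∀ y c, Φ.toEquiv (y * c) = Φ.toEquiv y * c := by
    have := Φ.map_rsmul
    rwa [h2] at this
  have hn : ∀ y, ‖Φ.toEquiv y‖ ≤ 1 * ‖y‖ := by
    intro y
    have := T.norm_linn (Φ.toEquiv y)
    rw [Φ.map_linn, T.norm_linn] at this
    rw [one_mul]
    exact (pow_le_pow_iff_left₀ (norm_nonneg _) (norm_nonneg _) two_ne_zero).1 this.ge
  let L : Cs →L[ℂ] Cs := Φ.toEquiv.toLinearMap.mkContinuous 1 hn
  have hL : ∀ y, L y = Φ.toEquiv y := fun y => rfl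
  let m : 𝓜(ℂ, Cs) := ⟨(L, L), fun x y => by
    show L x * y = x * L y
    rw [hL, hL, ← hl, hr]⟩
  have hm1 : ∀ y, m.fst y = Φ.toEquiv y := fun y => rfl
  have hm2 : ∀ y, m.snd y = Φ.toEquiv y := fun y => rfl
  have hex : ∃ z : ℂ, m = z • (1 : 𝓜(ℂ, Cs)) := by
    refine hcomm m fun c => m_ext (fun d => ?_) (fun d => ?_)
    · rw [m_mul_fst, m_mul_fst, hm1, hm1]
      exact hl c d
    · rw [m_mul_snd, m_mul_snd, hm2, hm2]
      exact (hr d c).symm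
  obtain ⟨z, hz⟩ := hex
  refine ⟨z, fun y => ?_⟩
  rw [← hm1, hz, DoubleCentralizer.smul_fst]
  show z • (1 : 𝓜(ℂ, Cs)).fst y = _
  rw [m_one_fst]

theorem part_two (ιs : As →⋆ₙₐ[ℂ] Cs)
    (hcomm : ∀ m : 𝓜(ℂ, Cs), (∀ c : Cs, m * (c : 𝓜(ℂ, Cs)) = (c : 𝓜(ℂ, Cs)) * m) →
      ∃ z : ℂ, m = z • (1 : 𝓜(ℂ, Cs)))
    (u v : 𝓜(ℂ, Cs)) (hu : mem_KMC ⇑ιs u) (hv : mem_KMC ⇑ιs v)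
    (T : EquivBimodule Cs Cs Cs) (hT : IsTrivialData T) :
    (PairEquiv T (AuSub ⇑ιs u) T (AuSub ⇑ιs v) ↔
          (u * star v ∈ unitary 𝓜(ℂ, Cs) ∧ IsMultiplierOf ⇑ιs (u * star v))) := by
  rw [isMult_iff ιs u v hu.1 hv.1]
  constructor
  · rintro ⟨Φ, hΦ⟩
    refine ⟨mul_mem hu.1 (Unitary.star_mem hv.1), ?_⟩
    obtain ⟨z, hz⟩ := iso_scalar hcomm T hT Φ
    refine le_antisymm ?_ ?_
    · intro x hx
      have h1 : z • x ∈ AuSub ⇑ιs v := by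
        rw [← hΦ, ← hz]
        exact ⟨x, hx, rfl⟩
      by_cases h0 : z = 0
      · have : x = 0 := by
          apply Φ.toEquiv.injective
          rw [hz, h0]; simp
        rw [this]; exact zero_mem _
      · have := Submodule.smul_mem _ z⁻¹ h1
        rwa [smul_smul, inv_mul_cancel₀ h0, one_smul] at this
    · intro y hy
      rw [← hΦ] at hy
      obtain ⟨x, hx, rfl⟩ := hy
      show Φ.toEquiv x ∈ _
      rw [hz]
      exact Submodule.smul_mem _ z hx
  · rintro ⟨-, he⟩
    refine ⟨⟨LinearEquiv.refl ℂ Cs, fun _ _ => rfl, fun _ _ => rfl, fun _ _ => rfl,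
      fun _ _ => rfl⟩, ?_⟩
    rw [← he]
    exact Submodule.map_id _

end two

section four
variable {As Cs I Y : Type*}
    [NonUnitalCStarAlgebra As]
    [NonUnitalCStarAlgebra Cs] [PartialOrder Cs] [StarOrderedRing Cs]
    [NormedAddCommGroup Y] [NormedSpace ℂ Y] [CompleteSpace Y]
    {l : Filter I} {s : I → Cs}

theorem part_four [l.NeBot] (ιs : As →⋆ₙₐ[ℂ] Cs) (hcl : IsClosed (Set.range ⇑ιs))
    (h : ShiftData (Set.range ⇑ιs) l s)
    (F : EquivBimodule Cs Cs Y) (X : Submodule ℂ Y)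
    (hF : IsEquiPair ⇑ιs F X) (Φ : Y ≃ₗᵢ[ℂ] Cs) (hΦl : ∀ y z, Φ y * star (Φ z) = F.linn y z)
    (hΦX : Φ '' (X : Set Y) = Set.range ⇑ιs)
    (T : EquivBimodule Cs Cs Cs) (hT : IsTrivialData T) (Ψ : F.Iso T) :
    ∃ u : 𝓜(ℂ, Cs), mem_KMC ⇑ιs u ∧ PairEquiv F X T (AuSub ⇑ιs u) := by
  obtain ⟨h1, h2, h3, h4⟩ := hT
  have hΨl : ∀ y z, Ψ.toEquiv y * star (Ψ.toEquiv z) = F.linn y z := by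
    have := Ψ.map_linn
    rwa [h3] at this
  have hΨr : ∀ y z, star (Ψ.toEquiv y) * Ψ.toEquiv z = F.rinn y z := by
    have := Ψ.map_rinn
    rwa [h4] at this
  have hΨs : ∀ y c, Ψ.toEquiv (F.rsmul y c) = Ψ.toEquiv y * c := by
    have := Ψ.map_rsmul
    rwa [h2] at this
  have hΨn : ∀ y, ‖Ψ.toEquiv y‖ = ‖y‖ := by
    intro y
    have := T.norm_linn (Ψ.toEquiv y)
    rw [Ψ.map_linn, F.norm_linn] at this
    exact ((pow_left_inj₀ (norm_nonneg _) (norm_nonneg _) two_ne_zero).1 this).symm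
  let Ψ' : Y ≃ₗᵢ[ℂ] Cs := ⟨Ψ.toEquiv, hΨn⟩
  have hΨ' : ∀ y, Ψ' y = Ψ.toEquiv y := fun _ => rfl
  let Θ : Cs ≃ₗᵢ[ℂ] Cs := Φ.symm.trans Ψ'
  have hΘΦ : ∀ y, Θ (Φ y) = Ψ.toEquiv y := fun y => by
    show Ψ' (Φ.symm (Φ y)) = _
    rw [LinearIsometryEquiv.symm_apply_apply]; rfl
  have hΘ : ∀ a b, Θ a * star (Θ b) = a * star b := by
    intro a b
    obtain ⟨y, rfl⟩ := Φ.surjective a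
    obtain ⟨z, rfl⟩ := Φ.surjective b
    rw [hΘΦ, hΘΦ, hΨl, hΦl]
  let Lf : Cs →L[ℂ] Cs := LinearMap.mkContinuous
    { toFun := fun c => star (Θ.symm (star c))
      map_add' := fun a b => by simp
      map_smul' := fun z a => by simp } 1 (fun c => by simp)
  have hLf : ∀ c, Lf c = star (Θ.symm (star c)) := fun c => rfl
  let u : 𝓜(ℂ, Cs) := ⟨(Lf, (Θ : Cs →L[ℂ] Cs)), fun x y => by
    show Θ x * y = x * Lf y
    rw [hLf, ← hΘ x, LinearIsometryEquiv.apply_symm_apply, star_star]⟩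
  have u1 : ∀ c, u.fst c = star (Θ.symm (star c)) := fun c => rfl
  have u2 : ∀ c, u.snd c = Θ c := fun c => rfl
  have u3 : ∀ c, (star u).fst c = star (Θ (star c)) := fun c => by
    rw [DoubleCentralizer.star_fst, u2]
  have u4 : ∀ c, (star u).snd c = Θ.symm c := fun c => by
    rw [DoubleCentralizer.star_snd, u1, star_star, star_star]
  have hu : u ∈ unitary 𝓜(ℂ, Cs) := by
    rw [Unitary.mem_iff]
    constructor
    · refine m_ext (fun c => ?_) (fun c => ?_)
      · rw [m_mul_fst, u3, u1, m_one_fst]; simp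
      · rw [m_mul_snd, u4, u2, m_one_snd]; simp
    · refine m_ext (fun c => ?_) (fun c => ?_)
      · rw [m_mul_fst, u3, u1, m_one_fst]; simp
      · rw [m_mul_snd, u4, u2, m_one_snd]; simp
  have hAu : X.map Ψ.toEquiv.toLinearMap = AuSub ⇑ιs u := by
    ext x
    rw [mem_AuSub]
    constructor
    · rintro ⟨y, hy, rfl⟩
      have : Φ y ∈ Set.range ⇑ιs := by rw [← hΦX]; exact ⟨y, hy, rfl⟩
      obtain ⟨a, ha⟩ := this
      refine ⟨a, ?_⟩
      rw [ha, u2, hΘΦ]; rfl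
    · rintro ⟨a, rfl⟩
      have : ιs a ∈ Φ '' (X : Set Y) := by rw [hΦX]; exact ⟨a, rfl⟩
      obtain ⟨y, hy, hya⟩ := this
      refine ⟨y, hy, ?_⟩
      rw [← hya, u2, hΘΦ]; rfl
  have hX : ∀ a ∈ Set.range ⇑ιs, ∃ y ∈ X, Ψ.toEquiv y = u.snd a := by
    rintro _ ⟨a, rfl⟩
    have : u.snd (ιs a) ∈ AuSub ⇑ιs u := (mem_AuSub ιs u _).2 ⟨a, rfl⟩
    rw [← hAu] at this
    exact this
  refine ⟨u, ⟨hu, ?_, ?_⟩, Ψ, hAu⟩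
  · intro b
    rw [mAd, m_fst_snd, ← mem_AuSub' ιs hu]
    refine (closed_AuSub ιs hcl hu).mem_of_tendsto (h.tend2 _) (Eventually.of_forall fun i => ?_)
    obtain ⟨y, hy, hyk⟩ := hX _ (h.kappa_mem i)
    rw [← u.central, ← hyk, ← hΨs, ← hAu]
    exact ⟨_, hF.rsmul_mem b y hy, rfl⟩
  · intro a
    have h5 := ((cont_mAd (star u)).tendsto _).comp (h.tend2 (ιs a))
    refine hcl.mem_of_tendsto h5 (Eventually.of_forall fun i => ?_)
    obtain ⟨y, hy, hyk⟩ := hX _ (h.kappa_mem i)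
    obtain ⟨z, hz, hza⟩ := hX _ ⟨a, rfl⟩
    simp only [Function.comp]
    have h6 := u_rinn (u := u) (s i * star (s i)) (ιs a)
    rw [h.kappa_star] at h6
    rw [← h6, ← hyk, ← hza, hΨr]
    exact hF.rinn_mem y hy z hz
end four

section three
variable {As Cs I V : Type*}
    [NonUnitalCStarAlgebra As]
    [NonUnitalCStarAlgebra Cs] [PartialOrder Cs] [StarOrderedRing Cs]
    [NormedAddCommGroup V] [NormedSpace ℂ V] [CompleteSpace V]
    {l : Filter I} {s : I → Cs}

lemma tensor_iso [l.NeBot] {S : Set Cs} (h : ShiftData S l s)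
    (T : EquivBimodule Cs Cs Cs) (hT : IsTrivialData T) (G : EquivBimodule Cs Cs V)
    (t : Cs → Cs → V) (ht : IsTensorProd T T G t) :
    ∃ Φ : V ≃ₗᵢ[ℂ] Cs, (∀ y w, Φ (t y w) = y * w) ∧
      (∀ x y, Φ x * star (Φ y) = G.linn x y) ∧ (∀ x y, star (Φ x) * Φ y = G.rinn x y) := by
  obtain ⟨h1, h2, h3, h4⟩ := hT
  let Q : Set (V × Cs) := {p | ∃ y w, p = (t y w, y * w)}
  let R : Submodule ℂ (V × Cs) := Submodule.span ℂ Q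
  have hl0 : ∀ y y' w w', G.linn (t y w) (t y' w') = (y * w) * star (y' * w') := by
    intro y y' w w'
    rw [ht.map_linn, h2, h3, star_mul]
    simp only [mul_assoc]
  have hr0 : ∀ y y' w w', G.rinn (t y w) (t y' w') = star (y * w) * (y' * w') := by
    intro y y' w w'
    rw [ht.map_rinn, h1, h4, star_mul]
    simp only [mul_assoc]
  have lz : ∀ x, G.linn x 0 = 0 := fun x => by simpa using G.linn_smul_right 0 x 0
  have lz' : ∀ x, G.linn 0 x = 0 := fun x => by simpa using G.linn_smul_left 0 0 x
  have rz : ∀ x, G.rinn x 0 = 0 := fun x => by simpa using G.rinn_smul_right 0 x 0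
  have rz' : ∀ x, G.rinn 0 x = 0 := fun x => by simpa using G.rinn_smul_left 0 0 x
  have hR : ∀ p ∈ R, ∀ q ∈ R, G.linn p.1 q.1 = p.2 * star q.2 ∧
      G.rinn p.1 q.1 = star p.2 * q.2 := by
    intro p hp q hq
    induction hp using Submodule.span_induction with
    | mem p hp =>
      obtain ⟨y, w, rfl⟩ := hp
      induction hq using Submodule.span_induction with
      | mem q hq =>
        obtain ⟨y', w', rfl⟩ := hq
        exact ⟨hl0 _ _ _ _, hr0 _ _ _ _⟩
      | zero => simp [lz, rz]
      | add a b _ _ ha hb =>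
        constructor
        · rw [Prod.fst_add, Prod.snd_add, G.linn_add_right, ha.1, hb.1, star_add, mul_add]
        · rw [Prod.fst_add, Prod.snd_add, G.rinn_add_right, ha.2, hb.2, mul_add]
      | smul z a _ ha =>
        constructor
        · rw [Prod.smul_fst, Prod.smul_snd, G.linn_smul_right, ha.1, star_smul, mul_smul_comm]
        · rw [Prod.smul_fst, Prod.smul_snd, G.rinn_smul_right, ha.2, mul_smul_comm]
    | zero => simp [lz', rz']
    | add a b _ _ ha hb =>
      constructor
      · rw [Prod.fst_add, Prod.snd_add, G.linn_add_left, ha.1, hb.1, add_mul]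
      · rw [Prod.fst_add, Prod.snd_add, G.rinn_add_left, ha.2, hb.2, star_add, add_mul]
    | smul z a _ ha =>
      constructor
      · rw [Prod.smul_fst, Prod.smul_snd, G.linn_smul_left, ha.1, smul_mul_assoc]
      · rw [Prod.smul_fst, Prod.smul_snd, G.rinn_smul_left, ha.2, star_smul, smul_mul_assoc]
  have hd1 : Dense (Prod.fst '' (R : Set (V × Cs))) := by
    refine ht.dense.mono ?_
    have : Submodule.span ℂ {v : V | ∃ y w, v = t y w} ≤ R.map (LinearMap.fst ℂ V Cs) := by
      rw [Submodule.span_le]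
      rintro _ ⟨y, w, rfl⟩
      exact ⟨(t y w, y * w), Submodule.subset_span ⟨y, w, rfl⟩, rfl⟩
    intro c hc
    obtain ⟨p, hp, hpc⟩ := this hc
    exact ⟨p, hp, hpc⟩
  have hd2 : Dense (Prod.snd '' (R : Set (V × Cs))) := by
    intro c
    refine isClosed_closure.mem_of_tendsto (h.tend1 c) (Eventually.of_forall fun i => ?_)
    exact subset_closure ⟨(t c (s i * star (s i)), c * (s i * star (s i))),
      Submodule.subset_span ⟨_, _, rfl⟩, rfl⟩
  have hn : ∀ p ∈ R, ‖p.1‖ = ‖p.2‖ := by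
    intro p hp
    have h5 := G.norm_linn p.1
    rw [(hR p hp p hp).1, CStarRing.norm_self_mul_star, ← sq] at h5
    exact ((pow_left_inj₀ (norm_nonneg _) (norm_nonneg _) two_ne_zero).1 h5).symm
  obtain ⟨Φ, hΦ⟩ := exists_isom R hn hd1 hd2
  have hext : ∀ x y, Φ x * star (Φ y) = G.linn x y ∧ star (Φ x) * Φ y = G.rinn x y := by
    have hA : ∀ p ∈ R, ∀ y, Φ p.1 * star (Φ y) = G.linn p.1 y ∧
        star (Φ p.1) * Φ y = G.rinn p.1 y := by
      intro p hp y
      constructor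
      · have hc : IsClosed {y | Φ p.1 * star (Φ y) = G.linn p.1 y} :=
          isClosed_eq (by fun_prop) (G.cont_linn_right _)
        refine hc.closure_subset_iff.2 ?_ (hd1 y)
        rintro _ ⟨q, hq, rfl⟩
        show Φ p.1 * star (Φ q.1) = G.linn p.1 q.1
        rw [hΦ p hp, hΦ q hq, (hR p hp q hq).1]
      · have hc : IsClosed {y | star (Φ p.1) * Φ y = G.rinn p.1 y} :=
          isClosed_eq (by fun_prop) (G.cont_rinn_right _)
        refine hc.closure_subset_iff.2 ?_ (hd1 y)
        rintro _ ⟨q, hq, rfl⟩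
        show star (Φ p.1) * Φ q.1 = G.rinn p.1 q.1
        rw [hΦ p hp, hΦ q hq, (hR p hp q hq).2]
    intro x y
    constructor
    · have hc : IsClosed {x | Φ x * star (Φ y) = G.linn x y} :=
        isClosed_eq (by fun_prop) (G.cont_linn_left _)
      refine hc.closure_subset_iff.2 ?_ (hd1 x)
      rintro _ ⟨q, hq, rfl⟩
      exact (hA q hq y).1
    · have hc : IsClosed {x | star (Φ x) * Φ y = G.rinn x y} :=
        isClosed_eq (by fun_prop) (G.cont_rinn_left _)
      refine hc.closure_subset_iff.2 ?_ (hd1 x)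
      rintro _ ⟨q, hq, rfl⟩
      exact (hA q hq y).2
  refine ⟨Φ, fun y w => ?_, fun x y => (hext x y).1, fun x y => (hext x y).2⟩
  exact hΦ (t y w, y * w) (Submodule.subset_span ⟨y, w, rfl⟩)

theorem part_three [l.NeBot] (ιs : As →⋆ₙₐ[ℂ] Cs) (hcl : IsClosed (Set.range ⇑ιs))
    (h : ShiftData (Set.range ⇑ιs) l s)
    (u v : 𝓜(ℂ, Cs)) (hu : mem_KMC ⇑ιs u) (hv : mem_KMC ⇑ιs v)
    (T : EquivBimodule Cs Cs Cs) (hT : IsTrivialData T)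
    (G : EquivBimodule Cs Cs V) (XV : Submodule ℂ V) (t : Cs → Cs → V)
    (ht : IsPairTensor ⇑ιs T (AuSub ⇑ιs u) T (AuSub ⇑ιs v) G XV t) :
    PairEquiv G XV T (AuSub ⇑ιs (u * v)) := by
  obtain ⟨Φ, hΦ, hΦl, hΦr⟩ := tensor_iso h T hT G t ht.tensor
  obtain ⟨h1, h2, h3, h4⟩ := hT
  have huv : u * v ∈ unitary 𝓜(ℂ, Cs) := mul_mem hu.1 hv.1
  have hcX : IsClosed (XV : Set V) := by rw [ht.sub]; exact isClosed_closure
  refine ⟨⟨Φ.toLinearEquiv, ?_, ?_, ?_, ?_⟩, ?_⟩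
  · intro c y
    show Φ (G.lsmul c y) = T.lsmul c (Φ y)
    rw [h1]
    refine eq_of_mul_right fun w => ?_
    obtain ⟨z, hz⟩ := Φ.surjective (star w)
    rw [← star_star w, ← hz, hΦl, G.linn_lsmul_left, mul_assoc, hΦl]
  · intro y c
    show Φ (G.rsmul y c) = T.rsmul (Φ y) c
    rw [h2]
    refine eq_of_mul_left fun w => ?_
    obtain ⟨z, hz⟩ := Φ.surjective (star w)
    rw [← star_star w, ← hz, hΦr, G.rinn_rsmul_right, ← mul_assoc, hΦr]
  · intro x y
    show T.linn (Φ x) (Φ y) = _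
    rw [h3]; exact hΦl x y
  · intro x y
    show T.rinn (Φ x) (Φ y) = _
    rw [h4]; exact hΦr x y
  · refine le_antisymm ?_ ?_
    · rintro _ ⟨x, hx, rfl⟩
      have hx' : x ∈ closure (Submodule.span ℂ {v_1 : V | ∃ x ∈ AuSub ⇑ιs u, ∃ z ∈ AuSub ⇑ιs v,
          v_1 = t x z} : Set V) := by rw [← ht.sub]; exact hx
      have hc : IsClosed {x | Φ x ∈ AuSub ⇑ιs (u * v)} :=
        (closed_AuSub ιs hcl huv).preimage Φ.continuous
      refine hc.closure_subset_iff.2 ?_ hx'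
      have : Submodule.span ℂ {v_1 : V | ∃ x ∈ AuSub ⇑ιs u, ∃ z ∈ AuSub ⇑ιs v, v_1 = t x z} ≤
          (AuSub ⇑ιs (u * v)).comap Φ.toLinearEquiv.toLinearMap := by
        rw [Submodule.span_le]
        rintro _ ⟨x, hx, z, hz, rfl⟩
        show Φ (t x z) ∈ AuSub ⇑ιs (u * v)
        obtain ⟨a, rfl⟩ := (mem_AuSub ιs u x).1 hx
        obtain ⟨b, rfl⟩ := (mem_AuSub ιs v z).1 hz
        obtain ⟨b', hb'⟩ := hu.2.1 b
        rw [hΦ, mem_AuSub]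
        refine ⟨a * b', ?_⟩
        rw [← m_snd_mul, u_snd_mul hu.1, m_mul_snd, map_mul ιs, hb']
      exact this
    · intro x hx
      obtain ⟨a, rfl⟩ := (mem_AuSub ιs (u * v) x).1 hx
      refine ⟨Φ.symm ((u * v).snd (ιs a)), ?_, Φ.apply_symm_apply _⟩
      have hcont : Continuous fun c => Φ.symm ((u * v).snd c) :=
        Φ.symm.continuous.comp (u * v).snd.continuous
      have h5 := (hcont.tendsto _).comp (h.tend1 (ιs a))
      refine hcX.mem_of_tendsto h5 (Eventually.of_forall fun i => ?_)
      obtain ⟨k, hk⟩ := h.kappa_mem i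
      obtain ⟨k', hk'⟩ := hu.2.2 k
      have h6 : (u * v).snd (ιs a * (s i * star (s i))) =
          Φ (t (u.snd (ιs a)) (v.snd (ιs k'))) := by
        rw [hΦ, ← m_snd_mul, u_snd_mul hu.1, m_mul_snd, hk', mAd_mAd' hu.1, hk]
      simp only [Function.comp]
      rw [h6, LinearIsometryEquiv.symm_apply_apply, ht.sub]
      exact subset_closure (Submodule.subset_span
        ⟨_, (mem_AuSub ιs u _).2 ⟨_, rfl⟩, _, (mem_AuSub ιs v _).2 ⟨_, rfl⟩, rfl⟩)
end three
end Helpers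

/-- For the stabilized inclusion `A^s ⊆ C^s` (with `A` σ-unital, `AC`
dense in `C`, and `(C^s)' ∩ M(C^s) = ℂ1`), there is an exact sequence
`1 → K(M(C^s))/U(M(A^s)) → Pic(A^s, C^s) → S(A^s, C^s) → 1`:
the map `u ↦ [A^s u, C^s]` induces an isomorphism of `K(M(C^s))/U(M(A^s))` onto
`Ker f_{C^s}` and the image of `f_{C^s} : [X,Y] ↦ [Y]` is `S(A^s, C^s)`. -/
theorem stabilized_kernel_image_fC
    {A C As Cs : Type*}
    [NonUnitalCStarAlgebra A] [PartialOrder A] [StarOrderedRing A]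
    [NonUnitalCStarAlgebra C] [PartialOrder C] [StarOrderedRing C]
    [NonUnitalCStarAlgebra As]
    [NonUnitalCStarAlgebra Cs] [PartialOrder Cs] [StarOrderedRing Cs]
    (ι : A →⋆ₙₐ[ℂ] C) (hι : Function.Injective ι) (hd : DenseIncl ⇑ι)
    (hσ : SigmaUnital A)
    (e : ℕ → ℕ → C → Cs) (hstab : IsStabilization e)
    (ιs : As →⋆ₙₐ[ℂ] Cs) (hιs : Function.Injective ιs) (hds : DenseIncl ⇑ιs)
    (hAs : Set.range ⇑ιs =
      closure (Submodule.span ℂ {x : Cs | ∃ i j a, x = e i j (ι a)} : Set Cs))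
    -- `(C^s)' ∩ M(C^s) = ℂ 1`
    (hcomm : ∀ m : 𝓜(ℂ, Cs), (∀ c : Cs, m * (c : 𝓜(ℂ, Cs)) = (c : 𝓜(ℂ, Cs)) * m) →
      ∃ z : ℂ, m = z • (1 : 𝓜(ℂ, Cs))) :
    -- (1) for `u ∈ K(M(C^s))`, `[A^s u, C^s] ∈ Pic(A^s, C^s)`, and it lies in `Ker f_{C^s}`
    (∀ u : 𝓜(ℂ, Cs), mem_KMC ⇑ιs u →
      ∀ T : EquivBimodule Cs Cs Cs, IsTrivialData T → IsEquiPair ⇑ιs T (AuSub ⇑ιs u)) ∧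
    -- (2) `[A^s u, C^s] = [A^s v, C^s]` iff `u v* ∈ U(M(A^s))`: the induced map on
    -- `K(M(C^s))/U(M(A^s))` is injective
    (∀ u v : 𝓜(ℂ, Cs), mem_KMC ⇑ιs u → mem_KMC ⇑ιs v →
      ∀ T : EquivBimodule Cs Cs Cs, IsTrivialData T →
        (PairEquiv T (AuSub ⇑ιs u) T (AuSub ⇑ιs v) ↔
          (u * star v ∈ unitary 𝓜(ℂ, Cs) ∧ IsMultiplierOf ⇑ιs (u * star v)))) ∧
    -- (3) `u ↦ [A^s u, C^s]` is multiplicative: `[A^s u][A^s v] = [A^s (uv)]`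
    (∀ u v : 𝓜(ℂ, Cs), mem_KMC ⇑ιs u → mem_KMC ⇑ιs v →
      ∀ T : EquivBimodule Cs Cs Cs, IsTrivialData T →
      ∀ (Vt : Type*) [NormedAddCommGroup Vt] [NormedSpace ℂ Vt] [CompleteSpace Vt]
        (G : EquivBimodule Cs Cs Vt) (XV : Submodule ℂ Vt) (s : Cs → Cs → Vt),
        IsPairTensor ⇑ιs T (AuSub ⇑ιs u) T (AuSub ⇑ιs v) G XV s →
          PairEquiv G XV T (AuSub ⇑ιs (u * v))) ∧
    -- (4) every element of `Ker f_{C^s}` is of the form `[A^s u, C^s]`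
    (∀ (Yt : Type*) [NormedAddCommGroup Yt] [NormedSpace ℂ Yt] [CompleteSpace Yt]
      (F : EquivBimodule Cs Cs Yt) (X : Submodule ℂ Yt), IsEquiPair ⇑ιs F X →
      ∀ T : EquivBimodule Cs Cs Cs, IsTrivialData T → Nonempty (F.Iso T) →
        ∃ u : 𝓜(ℂ, Cs), mem_KMC ⇑ιs u ∧ PairEquiv F X T (AuSub ⇑ιs u)) ∧
    -- (5) `Im f_{C^s} ⊆ S(A^s, C^s)` ...
    (∀ (Yt : Type*) [NormedAddCommGroup Yt] [NormedSpace ℂ Yt] [CompleteSpace Yt]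
      (F : EquivBimodule Cs Cs Yt) (X : Submodule ℂ Yt), IsEquiPair ⇑ιs F X →
        ∃ (α : Cs ≃⋆ₐ[ℂ] Cs), ⇑α '' Set.range ⇑ιs = Set.range ⇑ιs ∧
          ∃ (Eα : EquivBimodule Cs Cs Cs), IsAlphaData ⇑α ⇑α.symm Eα ∧
            Nonempty (F.Iso Eα)) ∧
    -- (6) ... and `S(A^s, C^s) ⊆ Im f_{C^s}`
    (∀ (α : Cs ≃⋆ₐ[ℂ] Cs), ⇑α '' Set.range ⇑ιs = Set.range ⇑ιs →
      ∀ (Eα : EquivBimodule Cs Cs Cs), IsAlphaData ⇑α ⇑α.symm Eα →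
        ∃ X : Submodule ℂ Cs, IsEquiPair ⇑ιs Eα X) := by
  have hcl : IsClosed (Set.range ⇑ιs) := by rw [hAs]; exact isClosed_closure
  obtain ⟨l, hl, h⟩ := exists_shift ι e hstab ιs hds hAs
  obtain ⟨H, hH⟩ := exists_genFam ι hσ e hstab ιs hAs
  refine ⟨fun u hu T hT => part_one ιs hcl h u hu T hT,
    fun u v hu hv T hT => part_two ιs hcomm u v hu hv T hT, ?_, ?_, ?_,
    fun α hα E hE => part_six ιs hcl h α hα E hE⟩
  · intro u v hu hv T hT Vt _ _ _ G XV s ht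
    exact part_three ιs hcl h u v hu hv T hT G XV s ht
  · rintro Yt _ _ _ F X hF T hT ⟨Ψ⟩
    obtain ⟨x, hx, hx1, hx2⟩ := exists_generic ιs h H hH F X hF
    obtain ⟨Φ, h1, h2, h3⟩ := core_iso ιs hcl h F X hF x hx hx1 hx2
    exact part_four ιs hcl h F X hF Φ h1 h3 T hT Ψ
  · intro Yt _ _ _ F X hF
    obtain ⟨x, hx, hx1, hx2⟩ := exists_generic ιs h H hH F X hF
    obtain ⟨Φ, h1, h2, h3⟩ := core_iso ιs hcl h F X hF x hx hx1 hx2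
    exact exists_alpha ιs hcl h F X hF Φ h1 h2 h3

end
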